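/- arXiv:2505.07124 — 12 statements merged into one kernel-verified Lean document; each statement's English description precedes it below -/
import Mathlib

section
/- Let n ≥ 1, let A be a symmetric positive definite real n × n matrix, let r > 0, and let x, ŷ ∈ ℝⁿ. Set B := A + r·I (which is positive definite) and let B^{1/2} denote its positive semidefinite square root. Then ⟨x, ŷ⟩ + (1/2)⟨A ŷ, ŷ⟩ + sup over y ∈ ℝⁿ of (⟨−x, y⟩ − (1/2)⟨A y, y⟩ − (r/2)‖y − ŷ‖²) = (1/2)‖(B^{1/2})⁻¹ (x − r ŷ) + B^{1/2} ŷ‖², where ⟨·,·⟩ and ‖·‖ are the Euclidean inner product and norm. In particular the supremum is finite. -/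
open Matrix

/-- Closed-form evaluation of the sharpened Fenchel-Young loss for quadratic
forms on ℝⁿ: with Ω(y) = ½⟨Ay,y⟩ and D(y'|y) = (r/2)‖y'-y‖², the loss equals
½‖B^{-1/2}(x - rŷ) + B^{1/2}ŷ‖² where B = A + rI.  Here `S` denotes the
positive semidefinite square root of `B` (which is positive definite). -/
theorem sharpened_FY_quadratic_closed_form
    (n : ℕ) (hn : 1 ≤ n)
    (A : Matrix (Fin n) (Fin n) ℝ) (hA : A.PosDef)
    (r : ℝ) (hr : 0 < r)
    (x yhat : Fin n → ℝ)
    (S : Matrix (Fin n) (Fin n) ℝ) (hS : S.PosSemidef)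
    (hSsq : S * S = A + r • (1 : Matrix (Fin n) (Fin n) ℝ)) :
    (A + r • (1 : Matrix (Fin n) (Fin n) ℝ)).PosDef ∧
    BddAbove {v : ℝ | ∃ y : Fin n → ℝ,
      v = (-x) ⬝ᵥ y - (1 / 2) * ((A *ᵥ y) ⬝ᵥ y)
            - (r / 2) * ((y - yhat) ⬝ᵥ (y - yhat))} ∧
    x ⬝ᵥ yhat + (1 / 2) * ((A *ᵥ yhat) ⬝ᵥ yhat) +
      sSup {v : ℝ | ∃ y : Fin n → ℝ,
        v = (-x) ⬝ᵥ y - (1 / 2) * ((A *ᵥ y) ⬝ᵥ y)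
              - (r / 2) * ((y - yhat) ⬝ᵥ (y - yhat))} =
      (1 / 2) * ((S⁻¹ *ᵥ (x - r • yhat) + S *ᵥ yhat) ⬝ᵥ
                 (S⁻¹ *ᵥ (x - r • yhat) + S *ᵥ yhat)) := by
  have hB : (A + r • (1 : Matrix (Fin n) (Fin n) ℝ)).PosDef :=
    hA.add (Matrix.PosDef.one.smul hr)
  have hdet : IsUnit S.det := by
    have h1 : (S * S).det ≠ 0 := by
      rw [hSsq]; exact hB.det_pos.ne'
    rw [Matrix.det_mul] at h1
    exact (left_ne_zero_of_mul h1).isUnit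
  have hT : Sᵀ = S := by
    have := hS.isHermitian.eq
    rwa [Matrix.conjTranspose_eq_transpose_of_trivial] at this
  have hsym : ∀ a b : Fin n → ℝ, (S *ᵥ a) ⬝ᵥ b = a ⬝ᵥ (S *ᵥ b) := by
    intro a b
    rw [Matrix.dotProduct_mulVec, ← Matrix.mulVec_transpose, hT]
  have hSS : ∀ y : Fin n → ℝ, (S *ᵥ y) ⬝ᵥ (S *ᵥ y) = (A *ᵥ y) ⬝ᵥ y + r * (y ⬝ᵥ y) := by
    intro y
    rw [← hsym, Matrix.mulVec_mulVec, hSsq, Matrix.add_mulVec, Matrix.smul_mulVec,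
      Matrix.one_mulVec, add_dotProduct, smul_dotProduct, smul_eq_mul]
  obtain ⟨w, hw⟩ : ∃ w, w = S⁻¹ *ᵥ (x - r • yhat) := ⟨_, rfl⟩
  have hSw : S *ᵥ w = x - r • yhat := by
    rw [hw, Matrix.mulVec_mulVec, Matrix.mul_nonsing_inv _ hdet, Matrix.one_mulVec]
  have hwy : ∀ y : Fin n → ℝ, w ⬝ᵥ (S *ᵥ y) = x ⬝ᵥ y - r * (yhat ⬝ᵥ y) := by
    intro y
    rw [← hsym, hSw, sub_dotProduct, smul_dotProduct, smul_eq_mul]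
  have key : ∀ y : Fin n → ℝ, (-x) ⬝ᵥ y - (1 / 2) * ((A *ᵥ y) ⬝ᵥ y)
            - (r / 2) * ((y - yhat) ⬝ᵥ (y - yhat)) =
      (1 / 2) * (w ⬝ᵥ w) - (r / 2) * (yhat ⬝ᵥ yhat)
        - (1 / 2) * ((w + S *ᵥ y) ⬝ᵥ (w + S *ᵥ y)) := by
    intro y
    simp only [neg_dotProduct, sub_dotProduct, dotProduct_sub, add_dotProduct, dotProduct_add]
    rw [dotProduct_comm (S *ᵥ y) w, hwy, hSS, dotProduct_comm y yhat]
    ring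
  have hG : IsGreatest {v : ℝ | ∃ y : Fin n → ℝ,
      v = (-x) ⬝ᵥ y - (1 / 2) * ((A *ᵥ y) ⬝ᵥ y)
            - (r / 2) * ((y - yhat) ⬝ᵥ (y - yhat))}
      ((1 / 2) * (w ⬝ᵥ w) - (r / 2) * (yhat ⬝ᵥ yhat)) := by
    constructor
    · refine ⟨-(S⁻¹ *ᵥ w), ?_⟩
      rw [key, Matrix.mulVec_neg, Matrix.mulVec_mulVec, Matrix.mul_nonsing_inv _ hdet,
        Matrix.one_mulVec]
      simp
    · rintro v ⟨y, rfl⟩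
      rw [key]
      have : 0 ≤ (w + S *ᵥ y) ⬝ᵥ (w + S *ᵥ y) :=
        Finset.sum_nonneg fun i _ => mul_self_nonneg _
      linarith
  refine ⟨hB, ⟨_, hG.2⟩, ?_⟩
  rw [hG.csSup_eq, ← hw]
  simp only [add_dotProduct, dotProduct_add]
  rw [dotProduct_comm (S *ᵥ yhat) w, hwy, hSS]
  ring
end

section
/- Let Θ be a real Hilbert space and let F : Θ → ℝ be convex and differentiable with gradient ∇F. Let θ⋆ ∈ Θ, K > ‖θ⋆‖, and 0 < α ≤ L be such that F is α-strongly convex on the closed ball B(0; K) of radius K centered at 0 and ∇F is L-Lipschitz on B(0; K). If ‖∇F(θ⋆)‖ ≤ ε and ε < α(K − ‖θ⋆‖), then F has a unique global minimizer θ̂, and it satisfies ‖θ̂ − θ⋆‖ ≤ ε/α. -/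
open Metric

theorem aux_limit (a b c : ℝ) (h : ∀ t : ℝ, 0 < t → t < 1 → a ≤ b - (1 - t) * c) :
    a ≤ b - c := by
  have h1 : Filter.Tendsto (fun t : ℝ => b - (1 - t) * c) (nhdsWithin 0 (Set.Ioi 0))
      (nhds (b - (1 - 0) * c)) :=
    (Continuous.tendsto (by fun_prop) 0).mono_left nhdsWithin_le_nhds
  have h2 : a ≤ b - (1 - 0) * c := by
    refine ge_of_tendsto h1 ?_
    filter_upwards [Ioo_mem_nhdsGT (show (0:ℝ) < 1 by norm_num)] with t ht
    exact h t ht.1 ht.2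
  linarith

theorem aux_convex_tangent {Θ : Type*} [NormedAddCommGroup Θ] [InnerProductSpace ℝ Θ]
    [CompleteSpace Θ] (F : Θ → ℝ) (g x y : Θ) (hg : HasGradientAt F g x) (α : ℝ)
    (h : ∀ t : ℝ, 0 ≤ t → t ≤ 1 →
        F (t • y + (1 - t) • x) ≤
          t * F y + (1 - t) * F x - α / 2 * t * (1 - t) * ‖y - x‖ ^ 2) :
    F x + inner ℝ g (y - x) + α / 2 * ‖y - x‖ ^ 2 ≤ F y := by
  have hl : HasDerivAt (fun t : ℝ => x + t • (y - x)) (y - x) 0 := by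
    simpa using ((hasDerivAt_id (0:ℝ)).smul_const (y - x)).const_add x
  have hF : HasFDerivAt F (InnerProductSpace.toDual ℝ Θ g) (x + (0:ℝ) • (y - x)) := by
    simpa using hg.hasFDerivAt
  have hd := hF.comp_hasDerivAt (0:ℝ) hl
  have hs := hd.tendsto_slope_zero_right
  simp only [InnerProductSpace.toDual_apply_apply, Function.comp, zero_add, zero_smul,
    add_zero, smul_eq_mul] at hs
  have h1 : Filter.Tendsto (fun t : ℝ => F y - F x - (1 - t) * (α / 2 * ‖y - x‖ ^ 2))
      (nhdsWithin 0 (Set.Ioi 0))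
      (nhds (F y - F x - (1 - 0) * (α / 2 * ‖y - x‖ ^ 2))) :=
    (Continuous.tendsto (by fun_prop) 0).mono_left nhdsWithin_le_nhds
  have := le_of_tendsto_of_tendsto hs h1 (by
    filter_upwards [Ioo_mem_nhdsGT (show (0:ℝ) < 1 by norm_num)] with t ht
    have h2 := h t ht.1.le ht.2.le
    have e : t • y + (1 - t) • x = x + t • (y - x) := by module
    rw [e] at h2
    rw [inv_mul_le_iff₀ ht.1]
    linarith)
  linarith

/-- Lemma A.1 (i): for a convex differentiable function that is locally strongly
convex and Lipschitz smooth on a ball, an approximate first-order condition at a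
point implies existence of a unique global minimizer nearby. -/
theorem approximate_stationary_point_i
    {Θ : Type*} [NormedAddCommGroup Θ] [InnerProductSpace ℝ Θ] [CompleteSpace Θ]
    (F : Θ → ℝ) (G : Θ → Θ)
    (hFconv : ConvexOn ℝ Set.univ F)
    (hgrad : ∀ x, HasGradientAt F (G x) x)
    (θstar : Θ) (K α L ε : ℝ)
    (hK : ‖θstar‖ < K) (hα : 0 < α) (hαL : α ≤ L)
    (hsc : ∀ x ∈ closedBall (0 : Θ) K, ∀ y ∈ closedBall (0 : Θ) K,
      ∀ t : ℝ, 0 ≤ t → t ≤ 1 →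
        F (t • x + (1 - t) • y) ≤
          t * F x + (1 - t) * F y - α / 2 * t * (1 - t) * ‖x - y‖ ^ 2)
    (hlip : ∀ x ∈ closedBall (0 : Θ) K, ∀ y ∈ closedBall (0 : Θ) K,
      ‖G x - G y‖ ≤ L * ‖x - y‖)
    (hε : ‖G θstar‖ ≤ ε) (hcond : ε < α * (K - ‖θstar‖)) :
    ∃ θhat : Θ, IsMinOn F Set.univ θhat ∧
      (∀ θ', IsMinOn F Set.univ θ' → θ' = θhat) ∧
      ‖θhat - θstar‖ ≤ ε / α := by
  have hε0 : 0 ≤ ε := (norm_nonneg _).trans hε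
  have hcont : Continuous F :=
    continuous_iff_continuousAt.2 fun x => (hgrad x).continuousAt
  set B := closedBall (0 : Θ) K with hB
  have hBconv : Convex ℝ B := convex_closedBall _ _
  have hsB : θstar ∈ B := by simpa [hB] using hK.le
  have htan : ∀ y ∈ B, F θstar + inner ℝ (G θstar) (y - θstar) + α / 2 * ‖y - θstar‖ ^ 2 ≤ F y :=
    fun y hy => aux_convex_tangent F _ θstar y (hgrad _) α (hsc y hy θstar hsB)
  have hcs : ∀ y, -(ε * ‖y - θstar‖) ≤ inner ℝ (G θstar) (y - θstar) := fun y => by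
    have h1 := neg_le_of_abs_le (abs_real_inner_le_norm (G θstar) (y - θstar))
    have h2 := mul_le_mul_of_nonneg_right hε (norm_nonneg (y - θstar))
    linarith
  have hbdd : BddBelow (F '' B) := by
    refine ⟨F θstar - ε ^ 2 / (2 * α), ?_⟩
    rintro _ ⟨y, hy, rfl⟩
    have h1 := htan y hy
    have h2 := hcs y
    have h3 : 0 ≤ α / 2 * (‖y - θstar‖ - ε / α) ^ 2 := by positivity
    have h4 : α / 2 * (‖y - θstar‖ - ε / α) ^ 2 =
      α / 2 * ‖y - θstar‖ ^ 2 - ε * ‖y - θstar‖ + ε ^ 2 / (2 * α) := by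
      field_simp
      ring
    linarith
  set m := sInf (F '' B) with hm
  have hmle : ∀ y ∈ B, m ≤ F y := fun y hy => csInf_le hbdd ⟨y, hy, rfl⟩
  have hex : ∀ n : ℕ, ∃ u ∈ B, F u < m + 1 / ((n : ℝ) + 1) := fun n => by
    obtain ⟨_, ⟨u, hu, rfl⟩, h⟩ := exists_lt_of_csInf_lt (s := F '' B) ⟨_, θstar, hsB, rfl⟩
      (show sInf (F '' B) < m + 1 / ((n : ℝ) + 1) by
        have : 0 < 1 / ((n : ℝ) + 1) := by positivity
        linarith)
    exact ⟨u, hu, h⟩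
  choose u huB hu using hex
  have hlim0 := tendsto_one_div_add_atTop_nhds_zero_nat (𝕜 := ℝ)
  have hcau : CauchySeq u := by
    refine cauchySeq_of_le_tendsto_0 (fun n : ℕ => √(8 / α * (1 / ((n : ℝ) + 1)))) ?_ ?_
    · intro p q N hp hq
      rw [dist_eq_norm]
      apply Real.le_sqrt_of_sq_le
      have hp' : 1 / ((p : ℝ) + 1) ≤ 1 / ((N : ℝ) + 1) := by gcongr
      have hq' : 1 / ((q : ℝ) + 1) ≤ 1 / ((N : ℝ) + 1) := by gcongr
      have h1 := hsc (u p) (huB p) (u q) (huB q) (1 / 2) (by norm_num) (by norm_num)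
      have h2 := hmle _ (hBconv (huB p) (huB q) (show (0:ℝ) ≤ 1 / 2 by norm_num)
        (show (0:ℝ) ≤ 1 - 1 / 2 by norm_num) (by norm_num))
      have h3 := hu p
      have h4 := hu q
      have h5 : α * ‖u p - u q‖ ^ 2 ≤ 8 * (1 / ((N : ℝ) + 1)) := by linarith
      rw [div_mul_eq_mul_div, le_div_iff₀ hα]
      linarith
    · have := (hlim0.const_mul (8 / α)).sqrt
      simpa using this
  obtain ⟨z, hz⟩ := cauchySeq_tendsto_of_complete hcau
  have hzB : z ∈ B := isClosed_closedBall.mem_of_tendsto hz (Filter.Eventually.of_forall huB)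
  have hFz : F z ≤ m := by
    have h1 := (hcont.tendsto z).comp hz
    have h2 : Filter.Tendsto (fun n : ℕ => m + 1 / ((n : ℝ) + 1)) Filter.atTop (nhds (m + 0)) :=
      hlim0.const_add m
    have := le_of_tendsto_of_tendsto' h1 h2 (fun n => (hu n).le)
    linarith
  have hgrow : ∀ y ∈ B, F z + α / 2 * ‖y - z‖ ^ 2 ≤ F y := fun y hy => by
    have := aux_limit (F z) (F y) (α / 2 * ‖y - z‖ ^ 2) (fun t h0 h1 => by
      have h2 := hsc y hy z hzB t h0.le h1.le
      have h3 := hFz.trans (hmle _ (hBconv hy hzB h0.le (show 0 ≤ 1 - t by linarith) (by ring)))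
      have h4 : 0 ≤ t * (F y - (1 - t) * (α / 2 * ‖y - z‖ ^ 2) - F z) := by linarith
      have := nonneg_of_mul_nonneg_right h4 h0
      linarith)
    linarith
  have hdist : ‖z - θstar‖ ≤ ε / α := by
    have h1 := hgrow θstar hsB
    have h2 := htan z hzB
    have h3 := hcs z
    rw [norm_sub_rev] at h1
    rw [le_div_iff₀ hα]
    by_contra! hlt
    have hpos : 0 < ‖z - θstar‖ := by
      by_contra! h
      nlinarith
    nlinarith
  have hzK : ‖z‖ < K := by
    have h1 : ε / α < K - ‖θstar‖ := by
      rw [div_lt_iff₀ hα]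
      linarith
    have h2 : ‖z‖ ≤ ‖z - θstar‖ + ‖θstar‖ := by
      simpa using norm_add_le (z - θstar) θstar
    linarith
  have hnhds : B ∈ nhds z := by
    refine Filter.mem_of_superset (isOpen_ball.mem_nhds (?_ : z ∈ ball (0 : Θ) K)) ball_subset_closedBall
    simpa using hzK
  have hmin : ∀ y, F z ≤ F y := by
    have hloc : IsLocalMin F z := by
      filter_upwards [hnhds] with y hy
      exact hFz.trans (hmle y hy)
    exact IsMinOn.of_isLocalMin_of_convex_univ hloc hFconv
  refine ⟨z, fun y _ => hmin y, ?_, hdist⟩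
  intro w hw
  have hwz : F w ≤ F z := hw (Set.mem_univ z)
  have hc : Filter.Tendsto (fun t : ℝ => t • w + (1 - t) • z) (nhdsWithin 0 (Set.Ioi 0)) (nhds z) := by
    have : Filter.Tendsto (fun t : ℝ => t • w + (1 - t) • z) (nhds 0)
        (nhds ((0:ℝ) • w + (1 - (0:ℝ)) • z)) := Continuous.tendsto (by fun_prop) 0
    simp only [zero_smul, sub_zero, one_smul, zero_add] at this
    exact this.mono_left nhdsWithin_le_nhds
  obtain ⟨t, htB, ht0, ht1⟩ := ((hc.eventually hnhds).and
    (Ioo_mem_nhdsGT (show (0:ℝ) < 1 by norm_num))).exists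
  have h1 := hgrow _ htB
  have h2 := hFconv.2 (Set.mem_univ w) (Set.mem_univ z) ht0.le (show 0 ≤ 1 - t by linarith) (by ring)
  simp only [smul_eq_mul] at h2
  have e : t • w + (1 - t) • z - z = t • (w - z) := by module
  rw [e, norm_smul, Real.norm_of_nonneg ht0.le] at h1
  have h3 : t * F w ≤ t * F z := mul_le_mul_of_nonneg_left hwz ht0.le
  by_contra hne
  have h4 : 0 < ‖w - z‖ := norm_pos_iff.2 (sub_ne_zero.2 hne)
  have h5 : 0 < α / 2 * (t * ‖w - z‖) ^ 2 := by positivity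
  linarith
end

section
/- Let Θ be a real Hilbert space and let F : Θ → ℝ be convex and differentiable with gradient ∇F. Let θ⋆ ∈ Θ, K > ‖θ⋆‖, and 0 < α ≤ L be such that F is α-strongly convex on the closed ball B(0; K) and ∇F is L-Lipschitz on B(0; K). Let R : Θ → ℝ be convex and lower semicontinuous, and let p⋆ ∈ Θ satisfy the subgradient inequality R(y) ≥ R(θ⋆) + ⟨p⋆, y − θ⋆⟩ for all y ∈ Θ. If ‖p⋆ + ∇F(θ⋆)‖ ≤ ε and ε < α(K − ‖θ⋆‖), then the function F + R has a unique global minimizer θ̂, and it satisfies ‖θ̂ − θ⋆‖ ≤ ε/α. -/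
open Metric
open scoped RealInnerProductSpace

open Filter Topology

lemma aux_lim (a b c : ℝ) (hb : 0 ≤ b) (h : ∀ t : ℝ, 0 < t → t < 1 → a + b * (1 - t) ≤ c) :
    a + b ≤ c := by
  by_contra hc
  push Not at hc
  have hd : 0 < a + b - c + b + 1 := by linarith
  have h1 := h ((a + b - c) / (a + b - c + b + 1)) (div_pos (by linarith) hd)
    ((div_lt_one hd).2 (by linarith))
  have h2 : b * ((a + b - c) / (a + b - c + b + 1)) < a + b - c := by
    rw [mul_div_assoc', div_lt_iff₀ hd]
    nlinarith
  linarith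

lemma aux_grad {Θ : Type*} [NormedAddCommGroup Θ] [InnerProductSpace ℝ Θ] [CompleteSpace Θ]
    (F : Θ → ℝ) (g x : Θ) (hF : ConvexOn ℝ Set.univ F) (hg : HasGradientAt F g x) (y : Θ) :
    F x + ⟪g, y - x⟫ ≤ F y := by
  have hc : ConvexOn ℝ Set.univ (fun t : ℝ => F (AffineMap.lineMap x y t)) := by
    exact hF.comp_affineMap (AffineMap.lineMap (k := ℝ) x y)
  have hd : HasDerivAt (fun t : ℝ => F (AffineMap.lineMap x y t)) ⟪g, y - x⟫ 0 := by
    have h1 : HasDerivAt (fun t : ℝ => (AffineMap.lineMap x y t : Θ)) (y - x) 0 :=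
      AffineMap.hasDerivAt_lineMap
    have h2 : HasFDerivAt F (InnerProductSpace.toDual ℝ Θ g)
        ((AffineMap.lineMap x y : ℝ →ᵃ[ℝ] Θ) 0) := by
      simpa using hg.hasFDerivAt
    exact h2.comp_hasDerivAt (0 : ℝ) h1
  have := hc.le_slope_of_hasDerivAt (Set.mem_univ 0) (Set.mem_univ 1) zero_lt_one hd
  simp [slope_def_field] at this
  linarith

lemma aux_exists {Θ : Type*} [NormedAddCommGroup Θ] [InnerProductSpace ℝ Θ] [CompleteSpace Θ]
    (H : Θ → ℝ) (S : Set Θ) (hS : IsClosed S) (hne : S.Nonempty) (hconv : Convex ℝ S)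
    (hl : LowerSemicontinuous H) (α B : ℝ) (hα : 0 < α) (hB : ∀ x ∈ S, B ≤ H x)
    (hsc : ∀ x ∈ S, ∀ y ∈ S, ∀ t : ℝ, 0 ≤ t → t ≤ 1 →
        H (t • x + (1 - t) • y) ≤ t * H x + (1 - t) * H y - α / 2 * t * (1 - t) * ‖x - y‖ ^ 2) :
    ∃ x ∈ S, ∀ y ∈ S, H x ≤ H y := by
  set m := sInf (H '' S) with hm
  have hbdd : BddBelow (H '' S) := ⟨B, by rintro _ ⟨x, hx, rfl⟩; exact hB x hx⟩
  have hmle : ∀ x ∈ S, m ≤ H x := fun x hx => csInf_le hbdd ⟨x, hx, rfl⟩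
  have hex : ∀ n : ℕ, ∃ x ∈ S, H x < m + 1 / ((n : ℝ) + 1) := by
    intro n
    obtain ⟨_, ⟨x, hx, rfl⟩, h⟩ := exists_lt_of_csInf_lt (hne.image H)
      (show sInf (H '' S) < m + 1 / ((n : ℝ) + 1) by
        have : 0 < 1 / ((n : ℝ) + 1) := by positivity
        linarith)
    exact ⟨x, hx, h⟩
  choose x hxS hx using hex
  have hlim := tendsto_one_div_add_atTop_nhds_zero_nat (𝕜 := ℝ)
  have hcau : CauchySeq x := by
    refine cauchySeq_of_le_tendsto_0 (fun n : ℕ => √(8 / α * (1 / ((n : ℝ) + 1)))) ?_ ?_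
    · intro i j N hi hj
      rw [dist_eq_norm]
      apply Real.le_sqrt_of_sq_le
      have h1 := hsc _ (hxS i) _ (hxS j) (1/2) (by norm_num) (by norm_num)
      have h2 := hmle _ (hconv (hxS i) (hxS j) (a := 1/2) (b := 1 - 1/2)
        (by norm_num) (by norm_num) (by norm_num))
      have h3 : 1 / ((i : ℝ) + 1) ≤ 1 / ((N : ℝ) + 1) := Nat.one_div_le_one_div hi
      have h4 : 1 / ((j : ℝ) + 1) ≤ 1 / ((N : ℝ) + 1) := Nat.one_div_le_one_div hj
      have h5 := hx i
      have h6 := hx j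
      rw [div_mul_eq_mul_div, le_div_iff₀ hα]
      linarith
    · have := (hlim.const_mul (8 / α)).sqrt
      simpa using this
  obtain ⟨z, hz⟩ := cauchySeq_tendsto_of_complete hcau
  have hzS : z ∈ S := hS.mem_of_tendsto hz (Eventually.of_forall hxS)
  refine ⟨z, hzS, fun y hy => le_trans ?_ (hmle y hy)⟩
  by_contra hcm
  push Not at hcm
  obtain ⟨d, hd1, hd2⟩ := exists_between hcm
  have e1 := hz.eventually (hl z d hd2)
  have e2 : ∀ᶠ n : ℕ in atTop, 1 / ((n : ℝ) + 1) < d - m :=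
    hlim.eventually (gt_mem_nhds (by linarith))
  obtain ⟨n, h1, h2⟩ := (e1.and e2).exists
  have := hx n
  linarith

/-- Lemma A.1 (ii): approximate first-order condition for a regularized problem
F + R implies existence of a unique global minimizer of F + R nearby. -/
theorem approximate_stationary_point_ii
    {Θ : Type*} [NormedAddCommGroup Θ] [InnerProductSpace ℝ Θ] [CompleteSpace Θ]
    (F : Θ → ℝ) (G : Θ → Θ)
    (hFconv : ConvexOn ℝ Set.univ F)
    (hgrad : ∀ x, HasGradientAt F (G x) x)
    (θstar : Θ) (K α L ε : ℝ)
    (hK : ‖θstar‖ < K) (hα : 0 < α) (hαL : α ≤ L)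
    (hsc : ∀ x ∈ closedBall (0 : Θ) K, ∀ y ∈ closedBall (0 : Θ) K,
      ∀ t : ℝ, 0 ≤ t → t ≤ 1 →
        F (t • x + (1 - t) • y) ≤
          t * F x + (1 - t) * F y - α / 2 * t * (1 - t) * ‖x - y‖ ^ 2)
    (hlip : ∀ x ∈ closedBall (0 : Θ) K, ∀ y ∈ closedBall (0 : Θ) K,
      ‖G x - G y‖ ≤ L * ‖x - y‖)
    (R : Θ → ℝ) (hRconv : ConvexOn ℝ Set.univ R) (hRlsc : LowerSemicontinuous R)
    (pstar : Θ) (hsub : ∀ y, R θstar + ⟪pstar, y - θstar⟫ ≤ R y)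
    (hε : ‖pstar + G θstar‖ ≤ ε) (hcond : ε < α * (K - ‖θstar‖)) :
    ∃ θhat : Θ, IsMinOn (fun θ => F θ + R θ) Set.univ θhat ∧
      (∀ θ', IsMinOn (fun θ => F θ + R θ) Set.univ θ' → θ' = θhat) ∧
      ‖θhat - θstar‖ ≤ ε / α := by
  have hconvB : Convex ℝ (closedBall (0 : Θ) K) := convex_closedBall 0 K
  have hsB : θstar ∈ closedBall (0 : Θ) K := by simpa using hK.le
  have hHc : ConvexOn ℝ Set.univ (fun θ => F θ + R θ) := hFconv.add hRconv
  have hFcont : Continuous F := continuous_iff_continuousAt.2 fun x => (hgrad x).continuousAt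
  have hHl : LowerSemicontinuous (fun θ => F θ + R θ) := hFcont.lowerSemicontinuous.add hRlsc
  have hHsc : ∀ x ∈ closedBall (0 : Θ) K, ∀ y ∈ closedBall (0 : Θ) K,
      ∀ t : ℝ, 0 ≤ t → t ≤ 1 →
        F (t • x + (1 - t) • y) + R (t • x + (1 - t) • y) ≤
          t * (F x + R x) + (1 - t) * (F y + R y) - α / 2 * t * (1 - t) * ‖x - y‖ ^ 2 := by
    intro x hx y hy t h0 h1
    have a1 := hsc x hx y hy t h0 h1
    have a2 := hRconv.2 (Set.mem_univ x) (Set.mem_univ y) h0 (sub_nonneg.2 h1) (by ring)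
    simp only [smul_eq_mul] at a2
    linarith
  have hin : ∀ y, -(ε * ‖y - θstar‖) ≤ ⟪pstar + G θstar, y - θstar⟫ := by
    intro y
    have h1 := abs_le.1 (abs_real_inner_le_norm (pstar + G θstar) (y - θstar))
    have h2 := mul_le_mul_of_nonneg_right hε (norm_nonneg (y - θstar))
    linarith [h1.1]
  have hlow : ∀ y ∈ closedBall (0 : Θ) K, F θstar + R θstar - ε * ‖y - θstar‖
      + α / 2 * ‖y - θstar‖ ^ 2 ≤ F y + R y := by
    intro y hy
    apply aux_lim _ _ _ (by positivity)
    intro t ht0 ht1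
    have a1 := hsc y hy θstar hsB t ht0.le ht1.le
    have a2 := aux_grad F _ _ hFconv (hgrad θstar) (t • y + (1 - t) • θstar)
    have a3 : t • y + (1 - t) • θstar - θstar = t • (y - θstar) := by module
    rw [a3, inner_smul_right] at a2
    have a4 := hsub y
    have a5 := hin y
    rw [inner_add_left] at a5
    have a6 : 0 ≤ t * (F y - F θstar - ⟪G θstar, y - θstar⟫
        - α / 2 * ‖y - θstar‖ ^ 2 * (1 - t)) := by linarith
    have a7 := nonneg_of_mul_nonneg_right a6 ht0
    linarith
  have hε0 : 0 ≤ ε := (norm_nonneg _).trans hε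
  obtain ⟨z, hzB, hz⟩ := aux_exists (fun θ => F θ + R θ) (closedBall (0 : Θ) K)
    isClosed_closedBall ⟨_, hsB⟩ hconvB hHl α (F θstar + R θstar - ε * (2 * K)) hα (by
      intro y hy
      have h1 := hlow y hy
      have h2 : ‖y - θstar‖ ≤ 2 * K := by
        have := norm_sub_le y θstar
        rw [mem_closedBall_zero_iff] at hy
        linarith
      have h3 := mul_le_mul_of_nonneg_left h2 hε0
      have h4 : 0 ≤ α / 2 * ‖y - θstar‖ ^ 2 := by positivity
      show _ ≤ F y + R y
      linarith) hHsc
  have hgrow : ∀ y ∈ closedBall (0 : Θ) K, F z + R z + α / 2 * ‖y - z‖ ^ 2 ≤ F y + R y := by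
    intro y hy
    apply aux_lim _ _ _ (by positivity)
    intro t ht0 ht1
    have a1 := hHsc y hy z hzB t ht0.le ht1.le
    have a2 := hz _ (hconvB hy hzB ht0.le (sub_nonneg.2 ht1.le) (by ring))
    have a6 : 0 ≤ t * (F y + R y - (F z + R z)
        - α / 2 * ‖y - z‖ ^ 2 * (1 - t)) := by linarith
    have a7 := nonneg_of_mul_nonneg_right a6 ht0
    linarith
  have hbound : ‖z - θstar‖ ≤ ε / α := by
    have h1 := hlow z hzB
    have h2 := hgrow θstar hsB
    rw [norm_sub_rev] at h2
    rw [le_div_iff₀ hα]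
    by_contra hc
    push Not at hc
    have h3 : 0 < ‖z - θstar‖ := by
      by_contra h
      have : ‖z - θstar‖ = 0 := le_antisymm (not_lt.1 h) (norm_nonneg _)
      rw [this] at hc
      linarith
    nlinarith
  have hzK : ‖z‖ < K := by
    have h1 : ε / α < K - ‖θstar‖ := by
      rw [div_lt_iff₀ hα]; linarith
    have h2 := norm_add_le (z - θstar) θstar
    rw [sub_add_cancel] at h2
    linarith
  have hnb : closedBall (0 : Θ) K ∈ 𝓝 z :=
    mem_of_superset (isOpen_ball.mem_nhds (by simpa using hzK)) ball_subset_closedBall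
  have hmin : ∀ y, F z + R z ≤ F y + R y := by
    have : IsLocalMin (fun θ => F θ + R θ) z := by
      filter_upwards [hnb] with y hy using hz y hy
    exact IsMinOn.of_isLocalMin_of_convex_univ this hHc
  refine ⟨z, fun y _ => hmin y, fun w hw => ?_, hbound⟩
  have hwz : F w + R w ≤ F z + R z := hw (Set.mem_univ z)
  have hcont : Tendsto (fun t : ℝ => t • w + (1 - t) • z) (𝓝[>] 0) (𝓝 z) := by
    have : Continuous (fun t : ℝ => t • w + (1 - t) • z) := by fun_prop
    have := this.tendsto 0
    simp only [zero_smul, sub_zero, one_smul, zero_add] at this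
    exact this.mono_left nhdsWithin_le_nhds
  obtain ⟨t, htB, ht0, ht1⟩ := ((hcont.eventually hnb).and
    (Ioo_mem_nhdsGT (zero_lt_one (α := ℝ)))).exists
  have a1 := hgrow _ htB
  have a2 := hHc.2 (Set.mem_univ w) (Set.mem_univ z) ht0.le (sub_nonneg.2 ht1.le) (by ring)
  simp only [smul_eq_mul] at a2
  have a3 : t • w + (1 - t) • z - z = t • (w - z) := by module
  rw [a3] at a1
  have a4 := mul_le_mul_of_nonneg_left hwz ht0.le
  have a5 : α / 2 * ‖t • (w - z)‖ ^ 2 ≤ 0 := by linarith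
  have a6 : ‖t • (w - z)‖ ^ 2 ≤ 0 := by
    by_contra h
    push Not at h
    have : 0 < α / 2 * ‖t • (w - z)‖ ^ 2 := by positivity
    linarith
  have a7 : ‖t • (w - z)‖ = 0 := by
    have := le_antisymm a6 (sq_nonneg _)
    simpa using this
  rw [norm_eq_zero, smul_eq_zero, sub_eq_zero] at a7
  exact a7.resolve_left ht0.ne'
end

section
/- Let H be a real Hilbert space, let R : H → ℝ be convex, let λ ≥ 0 and ε ≥ 0, and let x, x⋆ ∈ H satisfy ‖x − x⋆‖ ≤ ε. Let z ∈ H be a minimizer of the function ζ ↦ (1/2)‖x − ζ‖² + λR(ζ) over H, and let p⋆ ∈ H satisfy the subgradient inequality R(y) ≥ R(x⋆) + ⟨p⋆, y − x⋆⟩ for all y ∈ H. Then ‖z − x + λp⋆‖ ≤ λ‖p⋆‖ + ε, and consequently ‖x − z‖ ≤ 2λ‖p⋆‖ + ε. -/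
open scoped RealInnerProductSpace

/-- Lemma A.2 (proximal stability): the proximal point of x with respect to λR
moves by at most 2λ‖p⋆‖ + ε, where p⋆ is a subgradient of R at a point x⋆ with
‖x − x⋆‖ ≤ ε. -/
theorem prox_displacement_bound
    {H : Type*} [NormedAddCommGroup H] [InnerProductSpace ℝ H] [CompleteSpace H]
    (R : H → ℝ) (hRconv : ConvexOn ℝ Set.univ R)
    (lam ε : ℝ) (hlam : 0 ≤ lam) (hε : 0 ≤ ε)
    (x xstar : H) (hx : ‖x - xstar‖ ≤ ε)
    (z : H)
    (hz : IsMinOn (fun ζ => (1 / 2) * ‖x - ζ‖ ^ 2 + lam * R ζ) Set.univ z)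
    (pstar : H) (hsub : ∀ y, R xstar + ⟪pstar, y - xstar⟫ ≤ R y) :
    ‖z - x + lam • pstar‖ ≤ lam * ‖pstar‖ + ε ∧
    ‖x - z‖ ≤ 2 * lam * ‖pstar‖ + ε := by
  have key : ∀ t : ℝ, 0 < t → t ≤ 1 →
      ⟪x - z, xstar - z⟫ - lam * (R xstar - R z) ≤ t * (‖xstar - z‖ ^ 2 / 2) := by
    intro t ht ht1
    have h1 := hz (Set.mem_univ (z + t • (xstar - z)))
    have h2 := hRconv.2 (Set.mem_univ z) (Set.mem_univ xstar) (sub_nonneg.2 ht1) ht.le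
      (by ring)
    have e1 : (1 - t) • z + t • xstar = z + t • (xstar - z) := by module
    rw [e1] at h2
    simp only [Set.mem_ofPred_eq, smul_eq_mul] at h1 h2
    have e2 : x - (z + t • (xstar - z)) = (x - z) - t • (xstar - z) := by module
    rw [e2, norm_sub_sq_real (x - z), inner_smul_right, norm_smul, mul_pow, Real.norm_eq_abs, sq_abs] at h1
    have h3 := mul_le_mul_of_nonneg_left h2 hlam
    refine le_of_mul_le_mul_left ?_ ht
    nlinarith
  have hA : ⟪x - z, xstar - z⟫ - lam * (R xstar - R z) ≤ 0 := by
    by_contra! hA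
    set A := ⟪x - z, xstar - z⟫ - lam * (R xstar - R z)
    have hB : 0 ≤ ‖xstar - z‖ ^ 2 / 2 := by positivity
    set B := ‖xstar - z‖ ^ 2 / 2
    have h := key (A / (A + B)) (by positivity) (by rw [div_le_one (by positivity)]; linarith)
    rw [div_mul_eq_mul_div, le_div_iff₀ (by positivity)] at h
    nlinarith
  have hs := mul_le_mul_of_nonneg_left (hsub z) hlam
  have hw : ‖z - x + lam • pstar‖ ≤ lam * ‖pstar‖ + ε := by
    have e3 : ⟪z - x + lam • pstar, z - xstar⟫
        = ⟪x - z, xstar - z⟫ + lam * ⟪pstar, z - xstar⟫ := by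
      rw [inner_add_left, real_inner_smul_left, ← neg_sub x z, ← neg_sub xstar z, inner_neg_neg]
    set w := z - x + lam • pstar with hwdef
    have e4 : z - xstar = w - (lam • pstar - (x - xstar)) := by rw [hwdef]; module
    have h5 : ⟪w, z - xstar⟫ ≤ 0 := by rw [e3]; linarith
    rw [e4, inner_sub_right, real_inner_self_eq_norm_sq] at h5
    have h6 := real_inner_le_norm w (lam • pstar - (x - xstar))
    have h7 : ‖lam • pstar - (x - xstar)‖ ≤ lam * ‖pstar‖ + ε := by
      refine (norm_sub_le _ _).trans ?_
      rw [norm_smul, Real.norm_of_nonneg hlam]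
      linarith
    have h8 := mul_le_mul_of_nonneg_left h7 (norm_nonneg w)
    have h9 := norm_nonneg w
    have h10 : 0 ≤ lam * ‖pstar‖ + ε := by positivity
    by_contra! hc
    nlinarith
  refine ⟨hw, ?_⟩
  have e5 : x - z = lam • pstar - (z - x + lam • pstar) := by module
  rw [e5]
  refine (norm_sub_le _ _).trans ?_
  rw [norm_smul, Real.norm_of_nonneg hlam]
  linarith
end

section
/- Let q be a probability measure on a measurable space X and let g : X → ℝ be measurable and bounded (there exists B with |g(x)| ≤ B for all x). For t ∈ ℝ let Z_t := ∫ exp(−t g) dq (which is finite and strictly positive), and let p_t be the probability measure with density exp(−t g(x))/Z_t with respect to q. Let V := ∫ g² dq − (∫ g dq)². Then KL(p_t | q)/t² converges to V/2 as t → 0 with t ≠ 0; equivalently, KL(p_t | q) = (t²/2)·(∫ g² dq − (∫ g dq)²) + o(t²) as t → 0. -/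
open MeasureTheory Filter
open scoped Topology

/-- Lemma 4.1: second-order expansion of the Kullback-Leibler divergence of the
exponentially tilted measure p_t (with density exp(-t g)/Z_t with respect to q):
KL(p_t|q)/t² → Var_q(g)/2 as t → 0. -/
theorem kl_tilted_second_order
    {X : Type*} [MeasurableSpace X]
    (q : Measure X) [IsProbabilityMeasure q]
    (g : X → ℝ) (hg : Measurable g)
    (B : ℝ) (hB : ∀ x, |g x| ≤ B) :
    Tendsto
      (fun t : ℝ =>
        (∫ x, Real.log (Real.exp (-t * g x) / ∫ y, Real.exp (-t * g y) ∂q)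
            ∂(q.withDensity fun x =>
                ENNReal.ofReal (Real.exp (-t * g x) / ∫ y, Real.exp (-t * g y) ∂q)))
          / t ^ 2)
      (𝓝[≠] (0 : ℝ))
      (𝓝 ((∫ x, (g x) ^ 2 ∂q - (∫ x, g x ∂q) ^ 2) / 2)) := by
  set Y : X → ℝ := fun x => - g x with hY
  have hint : ∀ t : ℝ, Integrable (fun x => Real.exp (t * Y x)) q := by
    intro t
    refine Integrable.of_bound (C := Real.exp (|t| * B)) (by fun_prop) (ae_of_all _ fun x => ?_)
    rw [Real.norm_eq_abs, abs_of_pos (Real.exp_pos _)]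
    apply Real.exp_le_exp.2
    calc t * Y x ≤ |t * Y x| := le_abs_self _
      _ = |t| * |g x| := by rw [abs_mul, hY, abs_neg]
      _ ≤ |t| * B := by gcongr; exact hB x
  have hset : ProbabilityTheory.integrableExpSet Y q = Set.univ :=
    Set.eq_univ_of_forall hint
  have hmem : ∀ t : ℝ, t ∈ interior (ProbabilityTheory.integrableExpSet Y q) := by
    intro t; rw [hset, interior_univ]; trivial
  set c := ProbabilityTheory.cgf Y q with hc
  have hca : ∀ t, AnalyticAt ℝ c t := fun t => ProbabilityTheory.analyticAt_cgf (hmem t)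
  have hkey : ∀ t : ℝ, (∫ x, Real.log (Real.exp (-t * g x) / ∫ y, Real.exp (-t * g y) ∂q)
            ∂(q.withDensity fun x =>
                ENNReal.ofReal (Real.exp (-t * g x) / ∫ y, Real.exp (-t * g y) ∂q)))
      = t * deriv c t - c t := by
    intro t
    have e : ∀ x, -t * g x = t * Y x := fun x => by simp [hY]
    simp only [e]
    change ∫ x, _ ∂(q.tilted fun x => t * Y x) = _
    have hpos : 0 < ∫ y, Real.exp (t * Y y) ∂q := integral_exp_pos (hint t)
    have hprob := isProbabilityMeasure_tilted (hint t)
    have hYi : Integrable Y (q.tilted fun x => t * Y x) := by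
      refine Integrable.of_bound (C := B) ?_ (ae_of_all _ fun x => ?_)
      · exact hg.neg.aestronglyMeasurable
      · simpa [hY] using hB x
    simp_rw [Real.log_div (Real.exp_ne_zero _) hpos.ne', Real.log_exp]
    rw [integral_sub (hYi.const_mul t) (integrable_const _), integral_const_mul,
      ProbabilityTheory.integral_tilted_mul_self (hmem t)]
    simp [hc, ProbabilityTheory.cgf, ProbabilityTheory.mgf]
  simp only [hkey]
  have hV : deriv (deriv c) 0 = ∫ x, (g x) ^ 2 ∂q - (∫ x, g x ∂q) ^ 2 := by
    have h := ProbabilityTheory.iteratedDeriv_two_cgf (hmem 0)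
    rw [iteratedDeriv_succ, iteratedDeriv_one] at h
    rw [h, ProbabilityTheory.deriv_cgf_zero (hmem 0)]
    simp [hY, integral_neg]
  rw [← hV]
  have hd : ∀ t, HasDerivAt (fun t => t * deriv c t - c t) (t * deriv (deriv c) t) t := by
    intro t
    have h1 := (hca t).deriv.differentiableAt.hasDerivAt
    have h2 := (hca t).differentiableAt.hasDerivAt
    refine (((hasDerivAt_id t).mul h1).sub h2).congr_deriv ?_
    simp
  have hd2 : ∀ t : ℝ, HasDerivAt (fun t : ℝ => t ^ 2) (2 * t) t := by
    intro t; simpa using hasDerivAt_pow 2 t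
  refine HasDerivAt.lhopital_zero_nhdsNE (Eventually.of_forall hd) (Eventually.of_forall hd2)
    ?_ ?_ ?_ ?_
  · filter_upwards [self_mem_nhdsWithin] with t ht
    exact mul_ne_zero two_ne_zero ht
  · have := (hd 0).continuousAt.tendsto
    simp only [hc, ProbabilityTheory.cgf_zero, zero_mul, sub_zero] at this
    exact this.mono_left nhdsWithin_le_nhds
  · have := (hd2 0).continuousAt.tendsto
    simp at this
    exact this.mono_left nhdsWithin_le_nhds
  · have : Tendsto (fun t => deriv (deriv c) t / 2) (𝓝[≠] 0) (𝓝 (deriv (deriv c) 0 / 2)) :=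
      ((hca 0).deriv.deriv.continuousAt.tendsto.div_const 2).mono_left nhdsWithin_le_nhds
    refine this.congr' ?_
    filter_upwards [self_mem_nhdsWithin] with t ht
    have : t ≠ 0 := ht
    field_simp
end

section
/- Let q be a probability measure on a measurable space X and let g : X → ℝ be measurable and bounded (there exists B with |g(x)| ≤ B for all x). Then, as t → 0 with t ≠ 0, (log(∫ exp(−t g) dq) + t ∫ g dq)/t² converges to (∫ g² dq − (∫ g dq)²)/2; equivalently, log(∫ exp(−t g) dq) = −t ∫ g dq + (t²/2)(∫ g² dq − (∫ g dq)²) + o(t²). -/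
open MeasureTheory Filter
open scoped Topology

/-- Second-order expansion of the log-partition function of an exponential
tilt: (log Z_t + t·E_q[g])/t² → Var_q(g)/2 as t → 0. -/
theorem log_partition_second_order
    {X : Type*} [MeasurableSpace X]
    (q : Measure X) [IsProbabilityMeasure q]
    (g : X → ℝ) (hg : Measurable g)
    (B : ℝ) (hB : ∀ x, |g x| ≤ B) :
    Tendsto
      (fun t : ℝ =>
        (Real.log (∫ x, Real.exp (-t * g x) ∂q) + t * ∫ x, g x ∂q) / t ^ 2)
      (𝓝[≠] (0 : ℝ))
      (𝓝 ((∫ x, (g x) ^ 2 ∂q - (∫ x, g x ∂q) ^ 2) / 2)) := by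
  set Y : X → ℝ := fun x => -g x with hY
  have hs : ProbabilityTheory.integrableExpSet Y q = Set.univ := by
    ext t
    simp only [ProbabilityTheory.integrableExpSet, Set.mem_setOf_eq, Set.mem_univ, iff_true]
    refine Integrable.of_bound (C := Real.exp (|t| * B))
      (by fun_prop) (Eventually.of_forall fun x => ?_)
    rw [Real.norm_eq_abs, Real.abs_exp]
    apply Real.exp_le_exp.2
    refine (le_abs_self _).trans ?_
    rw [abs_mul, hY, abs_neg]
    exact mul_le_mul_of_nonneg_left (hB x) (abs_nonneg t)
  have hi : ∀ t, t ∈ interior (ProbabilityTheory.integrableExpSet Y q) := by simp [hs]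
  have hc : ContDiff ℝ (2 : ℕ) (ProbabilityTheory.cgf Y q) :=
    contDiff_iff_contDiffAt.2 fun t => (ProbabilityTheory.analyticAt_cgf (hi t)).contDiffAt
  have h1 : deriv (ProbabilityTheory.cgf Y q) 0 = -∫ x, g x ∂q := by
    rw [ProbabilityTheory.deriv_cgf_zero (hi 0)]
    simp [hY, integral_neg]
  have h2 : iteratedDeriv 2 (ProbabilityTheory.cgf Y q) 0
      = ∫ x, (g x) ^ 2 ∂q - (∫ x, g x ∂q) ^ 2 := by
    rw [ProbabilityTheory.iteratedDeriv_two_cgf (hi 0), h1]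
    simp [hY]
  have hT := (taylor_isLittleO_univ (x₀ := 0) hc).tendsto_div_nhds_zero
  have hT' := (hT.mono_left (nhdsWithin_le_nhds (s := {0}ᶜ))).add_const
    ((∫ x, (g x) ^ 2 ∂q - (∫ x, g x ∂q) ^ 2) / 2)
  rw [zero_add] at hT'
  refine hT'.congr' ?_
  filter_upwards [self_mem_nhdsWithin] with t ht
  have ht : t ≠ 0 := ht
  have e : ProbabilityTheory.cgf Y q t = Real.log (∫ x, Real.exp (-t * g x) ∂q) := by
    simp [ProbabilityTheory.cgf, ProbabilityTheory.mgf, hY]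
  simp only [taylorWithinEval_succ, taylor_within_zero_eval, iteratedDerivWithin_univ, h2,
    iteratedDeriv_one, zero_add, h1, e, ProbabilityTheory.cgf_zero]
  simp
  field_simp
  ring
end

section
/- Let E be a finite-dimensional real inner product space. Let F : E → ℝ be strictly convex and differentiable with gradient ∇F, and let R : E → ℝ be convex and Lipschitz continuous. For each λ ≥ 0 let θ^λ ∈ E be a global minimizer of the function θ ↦ F(θ) + λR(θ), and set θ⋆ := θ⁰ (the minimizer of F). Suppose the gradient map ∇F is differentiable at θ⋆ with derivative H : E → E (a linear map), that H is symmetric (⟨H u, v⟩ = ⟨u, H v⟩ for all u, v), and that H is invertible with inverse H⁻¹. Then there exists z⋆ ∈ E such that: (a) z⋆ is a subgradient of R at θ⋆, i.e. R(y) ≥ R(θ⋆) + ⟨z⋆, y − θ⋆⟩ for all y; (b) z⋆ minimizes the quadratic form z ↦ ⟨z, H⁻¹ z⟩ over all subgradients z of R at θ⋆; and (c) −(1/λ)·∇F(θ^λ) converges to z⋆ as λ → 0 with λ > 0. -/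
open Filter
open scoped Topology RealInnerProductSpace

theorem aux_subgrad {E : Type*} [NormedAddCommGroup E] [InnerProductSpace ℝ E] [CompleteSpace E]
    (f h : E → ℝ) (g x : E) (hf : HasGradientAt f g x) (hh : ConvexOn ℝ Set.univ h)
    (hmin : ∀ y, f x + h x ≤ f y + h y) (y : E) : h x - ⟪g, y - x⟫ ≤ h y := by
  have h1 : HasDerivAt (fun t : ℝ => x + t • (y - x)) (y - x) 0 := by
    simpa using ((hasDerivAt_id (0:ℝ)).smul_const (y - x)).const_add x
  have hf' : HasFDerivAt f (InnerProductSpace.toDual ℝ E g) (x + (0:ℝ) • (y - x)) := by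
    simpa using hf.hasFDerivAt
  have h2 : HasDerivAt (fun t : ℝ => f (x + t • (y - x))) ⟪g, y - x⟫ 0 := by
    have h := hf'.comp_hasDerivAt (0:ℝ) h1
    rw [InnerProductSpace.toDual_apply_apply] at h
    exact h
  have h3 := h2.hasDerivWithinAt (s := Set.Ioi 0)
  rw [hasDerivWithinAt_iff_tendsto_slope' (by simp)] at h3
  have h4 : -(h y - h x) ≤ ⟪g, y - x⟫ := by
    refine ge_of_tendsto h3 ?_
    filter_upwards [Ioo_mem_nhdsGT (zero_lt_one' ℝ)] with t ht
    have hc := hh.2 (Set.mem_univ x) (Set.mem_univ y) (sub_nonneg.2 ht.2.le) ht.1.le (by ring)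
    have e : (1 - t) • x + t • y = x + t • (y - x) := by module
    rw [e] at hc
    have hm := hmin (x + t • (y - x))
    simp only [smul_eq_mul] at hc
    rw [slope_def_field]
    simp only [zero_smul, add_zero, sub_zero]
    rw [le_div_iff₀ ht.1]
    nlinarith
  linarith

theorem aux_pd {E : Type*} [NormedAddCommGroup E] [InnerProductSpace ℝ E]
    (H : E →L[ℝ] E) (hs : ∀ u v : E, ⟪H u, v⟫ = ⟪u, H v⟫) (hp : ∀ u, 0 ≤ ⟪H u, u⟫)
    (w : E) (hw : ⟪H w, w⟫ ≤ 0) : H w = 0 := by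
  have h0 : ⟪H w, w⟫ = 0 := le_antisymm hw (hp w)
  by_contra hne
  have ha : 0 < ⟪H w, H w⟫ := by rw [real_inner_self_eq_norm_sq]; positivity
  set a := ⟪H w, H w⟫ with hadef
  set b := ⟪H (H w), H w⟫ with hb
  have hb0 : 0 ≤ b := hp _
  have key : ∀ t : ℝ, 0 ≤ -2 * t * a + t ^ 2 * b := by
    intro t
    have := hp (w - t • H w)
    simp only [map_sub, map_smul, inner_sub_left, inner_sub_right, inner_smul_left,
      inner_smul_right, h0, hs (H w) w] at this
    simp at this
    rw [hadef, real_inner_self_eq_norm_sq]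
    nlinarith
  have := key (a / (b + 1))
  have e : -2 * (a / (b + 1)) * a + (a / (b + 1)) ^ 2 * b
      = (a / (b + 1)) ^ 2 * (-2 * (b + 1) + b) := by
    field_simp
  rw [e] at this
  have hpos : 0 < (a / (b + 1)) ^ 2 := by positivity
  nlinarith

theorem aux_growth {E : Type*} [NormedAddCommGroup E] [InnerProductSpace ℝ E]
    [FiniteDimensional ℝ E] (F : E → ℝ) (hF : StrictConvexOn ℝ Set.univ F) (hc : Continuous F)
    (x : E) (hx : ∀ y, F x ≤ F y) (r : ℝ) (hr : 0 < r) :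
    ∃ c > 0, ∀ y, r ≤ ‖y - x‖ → c * ‖y - x‖ ≤ F y - F x := by
  have hs : ∃ c > 0, ∀ y ∈ Metric.sphere x r, c ≤ F y - F x := by
    rcases (Metric.sphere x r).eq_empty_or_nonempty with he | hne
    · exact ⟨1, one_pos, by simp [he]⟩
    · obtain ⟨m, hm, hmin⟩ := (isCompact_sphere x r).exists_isMinOn hne hc.continuousOn
      refine ⟨F m - F x, ?_, fun y hy => sub_le_sub_right (hmin hy) _⟩
      rcases (hx m).lt_or_eq with h | h
      · linarith
      · exfalso
        have : m = x := hF.eq_of_isMinOn (fun y _ => by simpa [← h] using hx y)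
          (fun y _ => hx y) (Set.mem_univ _) (Set.mem_univ _)
        rw [this] at hm
        simp at hm
        linarith
  obtain ⟨c, hc0, hcs⟩ := hs
  refine ⟨c / r, by positivity, fun y hy => ?_⟩
  have hn : 0 < ‖y - x‖ := hr.trans_le hy
  set t := r / ‖y - x‖ with ht
  have ht0 : 0 < t := by positivity
  have ht1 : t ≤ 1 := (div_le_one hn).2 hy
  have h1 := hF.convexOn.2 (Set.mem_univ x) (Set.mem_univ y) (sub_nonneg.2 ht1) ht0.le (by ring)
  have e : (1 - t) • x + t • y = x + t • (y - x) := by module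
  rw [e] at h1
  simp only [smul_eq_mul] at h1
  have h2 := hcs (x + t • (y - x)) (by
    simp only [mem_sphere_iff_norm, add_sub_cancel_left, norm_smul, Real.norm_eq_abs,
      abs_of_pos ht0]
    rw [ht]; field_simp)
  have h3 : c ≤ t * (F y - F x) := by linarith
  rw [ht, div_mul_eq_mul_div, le_div_iff₀ hn] at h3
  rw [div_mul_eq_mul_div, div_le_iff₀ hr]
  linarith

/-- Proposition B.1 (minimal norm certificate): for a Tikhonov regularization
path θ^λ of a strictly convex smooth fit term F and a convex Lipschitz
regularizer R, the normalized dual variables -∇F(θ^λ)/λ converge, as λ → 0⁺, to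
the subgradient of R at θ⋆ of minimal H⁻¹-weighted norm, where H = ∇²F(θ⋆). -/
theorem minimal_norm_certificate
    {E : Type*} [NormedAddCommGroup E] [InnerProductSpace ℝ E]
    [FiniteDimensional ℝ E]
    (F : E → ℝ) (G : E → E)
    (hFstrict : StrictConvexOn ℝ Set.univ F)
    (hgrad : ∀ x, HasGradientAt F (G x) x)
    (R : E → ℝ) (hRconv : ConvexOn ℝ Set.univ R)
    (hRlip : ∃ C : NNReal, LipschitzWith C R)
    (θfun : ℝ → E)
    (hθmin : ∀ lam : ℝ, 0 ≤ lam →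
      IsMinOn (fun θ => F θ + lam * R θ) Set.univ (θfun lam))
    (θstar : E) (hθstar : θstar = θfun 0)
    (Hm : E →L[ℝ] E) (hH : HasFDerivAt G Hm θstar)
    (hHsymm : ∀ u v : E, ⟪Hm u, v⟫ = ⟪u, Hm v⟫)
    (Hinv : E →L[ℝ] E)
    (hHinv : ∀ u : E, Hinv (Hm u) = u ∧ Hm (Hinv u) = u) :
    ∃ zstar : E,
      (∀ y, R θstar + ⟪zstar, y - θstar⟫ ≤ R y) ∧
      (∀ z : E, (∀ y, R θstar + ⟪z, y - θstar⟫ ≤ R y) →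
        ⟪zstar, Hinv zstar⟫ ≤ ⟪z, Hinv z⟫) ∧
      Tendsto (fun lam : ℝ => (-(1 / lam)) • G (θfun lam)) (𝓝[>] (0 : ℝ))
        (𝓝 zstar) := by
  obtain ⟨L, hL⟩ := hRlip
  have hst : ∀ y, F θstar ≤ F y := by
    intro y
    have := hθmin 0 le_rfl (Set.mem_univ y)
    simpa [hθstar] using this
  have hFc : Continuous F := continuous_iff_continuousAt.2 fun x => (hgrad x).continuousAt
  -- basic monotonicity
  have hFsub : ∀ x y, F x + ⟪G x, y - x⟫ ≤ F y := by
    intro x y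
    have hneg : HasGradientAt (fun y => - F y) (- G x) x := by
      have := (hgrad x).hasFDerivAt.neg
      rw [hasGradientAt_iff_hasFDerivAt]
      rw [map_neg]
      exact this
    have := aux_subgrad (fun y => - F y) F (- G x) x hneg hFstrict.convexOn (by simp) y
    simpa using this
  have hG0 : G θstar = 0 := by
    have : IsLocalMin F θstar := Eventually.of_forall hst
    have h2 := this.hasFDerivAt_eq_zero (hgrad θstar).hasFDerivAt
    simpa using h2
  have hpsd : ∀ u, 0 ≤ ⟪Hm u, u⟫ := by
    intro u
    have h1 : HasDerivAt (fun t : ℝ => θstar + t • u) u 0 := by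
      simpa using ((hasDerivAt_id (0:ℝ)).smul_const u).const_add θstar
    have hH' : HasFDerivAt G Hm (θstar + (0:ℝ) • u) := by simpa using hH
    have h2 : HasDerivAt (fun t : ℝ => G (θstar + t • u)) (Hm u) 0 :=
      hH'.comp_hasDerivAt (0:ℝ) h1
    have h3 : HasDerivAt (fun t : ℝ => ⟪G (θstar + t • u), u⟫) ⟪Hm u, u⟫ 0 := by
      simpa using h2.inner ℝ (hasDerivAt_const (0:ℝ) u)
    have h3 := h3.hasDerivWithinAt (s := Set.Ioi 0)
    rw [hasDerivWithinAt_iff_tendsto_slope' (by simp)] at h3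
    refine ge_of_tendsto h3 ?_
    filter_upwards [self_mem_nhdsWithin] with t ht
    have ht : 0 < t := ht
    have ha := hFsub (θstar + t • u) θstar
    have hb := hst (θstar + t • u)
    have e : θstar - (θstar + t • u) = (-t) • u := by module
    rw [e, inner_smul_right] at ha
    rw [slope_def_field]
    simp only [zero_smul, add_zero, sub_zero, hG0, inner_zero_left]
    apply div_nonneg _ ht.le
    by_contra hcon
    push Not at hcon
    nlinarith
  have hpd : ∀ x, ⟪x, Hinv x⟫ ≤ 0 → x = 0 := by
    intro x hx
    have := aux_pd Hm hHsymm hpsd (Hinv x) (by rwa [(hHinv x).2])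
    rwa [(hHinv x).2] at this
  have hpsd' : ∀ x, 0 ≤ ⟪x, Hinv x⟫ := by
    intro x
    have := hpsd (Hinv x)
    rwa [(hHinv x).2] at this
  have hsymm' : ∀ x y, ⟪x, Hinv y⟫ = ⟪y, Hinv x⟫ := by
    intro x y
    have := hHsymm (Hinv x) (Hinv y)
    rw [(hHinv x).2, (hHinv y).2] at this
    rw [this, real_inner_comm]
  set g : ℝ → E := fun lam => (-(1 / lam)) • G (θfun lam) with hg
  have hsub : ∀ lam > 0, ∀ y, R (θfun lam) + ⟪g lam, y - θfun lam⟫ ≤ R y := by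
    intro lam hlam y
    have hcv : ConvexOn ℝ Set.univ (fun y => lam * R y) := by
      simpa using hRconv.smul hlam.le
    have := aux_subgrad F (fun y => lam * R y) _ _ (hgrad (θfun lam)) hcv
      (fun y => hθmin lam hlam.le (Set.mem_univ y)) y
    simp only [hg, inner_smul_left]
    have h2 : lam * (R (θfun lam) + -(1 / lam) * ⟪G (θfun lam), y - θfun lam⟫) ≤ lam * R y := by
      have e : lam * (R (θfun lam) + -(1 / lam) * ⟪G (θfun lam), y - θfun lam⟫)
        = lam * R (θfun lam) - ⟪G (θfun lam), y - θfun lam⟫ := by field_simp; ring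
      rw [e]; exact this
    simpa using le_of_mul_le_mul_left h2 hlam
  have hRL : ∀ x y, R x - R y ≤ L * ‖x - y‖ := by
    intro x y
    have := hL.dist_le_mul x y
    rw [Real.dist_eq, dist_eq_norm] at this
    exact (le_abs_self _).trans this
  have hbd : ∀ lam > 0, ‖g lam‖ ≤ L := by
    intro lam hlam
    have h1 := hsub lam hlam (θfun lam + g lam)
    have h2 := hRL (θfun lam + g lam) (θfun lam)
    rw [add_sub_cancel_left] at h1 h2
    rw [real_inner_self_eq_norm_sq] at h1
    by_contra hcon
    push Not at hcon
    have : (0:ℝ) ≤ L := L.2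
    nlinarith
  have hθlim : Tendsto θfun (𝓝[>] (0:ℝ)) (𝓝 θstar) := by
    rw [Metric.tendsto_nhds]
    intro r hr
    obtain ⟨c, hc, hgr⟩ := aux_growth F hFstrict hFc θstar hst r hr
    have hL0 : (0:ℝ) ≤ L := L.2
    have hd : 0 < c / (L + 1) := by positivity
    filter_upwards [Ioo_mem_nhdsGT hd] with lam hlam
    rw [dist_eq_norm]
    by_contra hcon
    push Not at hcon
    have h1 := hgr _ hcon
    have h2 : F (θfun lam) + lam * R (θfun lam) ≤ F θstar + lam * R θstar :=
      hθmin lam hlam.1.le (Set.mem_univ θstar)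
    have h3 := mul_le_mul_of_nonneg_left (hRL θstar (θfun lam)) hlam.1.le
    rw [norm_sub_rev] at h3
    have h4 := (lt_div_iff₀ (by positivity)).1 hlam.2
    have h5 : lam * L < c := by linarith [hlam.1]
    have hn : 0 < ‖θfun lam - θstar‖ := hr.trans_le hcon
    nlinarith
  have hGg : ∀ lam > 0, G (θfun lam) = (-lam) • g lam := by
    intro lam hlam
    simp only [hg, smul_smul]
    have : -lam * -(1 / lam) = 1 := by field_simp
    rw [this, one_smul]
  -- expansion
  have hlo : (fun lam => Hinv (G (θfun lam)) - (θfun lam - θstar))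
      =o[𝓝[>] (0:ℝ)] (fun lam => θfun lam - θstar) := by
    have h1 := (hH.isLittleO).comp_tendsto hθlim
    have h2 := (Hinv.isBigO_comp (fun lam => G (θfun lam) - G θstar - Hm (θfun lam - θstar))
      (𝓝[>] (0:ℝ))).trans_isLittleO h1
    refine h2.congr_left ?_
    intro lam
    rw [hG0, sub_zero, map_sub, (hHinv _).1]
  have hGO : (fun lam => Hinv (G (θfun lam))) =O[𝓝[>] (0:ℝ)] (fun lam : ℝ => lam) := by
    refine (Hinv.isBigO_comp (fun lam => G (θfun lam)) _).trans ?_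
    refine Asymptotics.IsBigO.of_bound L ?_
    filter_upwards [self_mem_nhdsWithin] with lam hlam
    rw [hGg lam hlam, norm_smul, norm_neg, mul_comm]
    exact mul_le_mul_of_nonneg_right (hbd lam hlam) (norm_nonneg _)
  have hO : (fun lam => θfun lam - θstar) =O[𝓝[>] (0:ℝ)] (fun lam : ℝ => lam) := by
    refine Asymptotics.IsBigO.trans ?_ hGO
    have := hlo.right_isBigO_add
    refine this.congr_right ?_
    intro lam; simp
  have hv0 := (hlo.trans_isBigO hO).tendsto_inv_smul_nhds_zero
  have hv : Tendsto (fun lam : ℝ => lam⁻¹ • (θfun lam - θstar) + Hinv (g lam)) (𝓝[>] (0:ℝ))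
      (𝓝 0) := by
    have := hv0.neg
    rw [neg_zero] at this
    refine this.congr ?_
    intro lam
    simp only [hg, map_smul, one_div]
    module
  -- cluster points
  have hclus : ∀ z0, MapClusterPt z0 (𝓝[>] (0:ℝ)) g →
      (∀ y, R θstar + ⟪z0, y - θstar⟫ ≤ R y) ∧
      (∀ z : E, (∀ y, R θstar + ⟪z, y - θstar⟫ ≤ R y) → ⟪z0 - z, Hinv z0⟫ ≤ 0) := by
    intro z0 hz0
    obtain ⟨U, hU, hgU⟩ := mapClusterPt_iff_ultrafilter.1 hz0
    have hθU := hθlim.mono_left hU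
    have hpos : ∀ᶠ lam in (U : Filter ℝ), 0 < lam := hU self_mem_nhdsWithin
    refine ⟨fun y => ?_, fun z hz => ?_⟩
    · have h1 : Tendsto (fun lam => R (θfun lam) + ⟪g lam, y - θfun lam⟫) U
          (𝓝 (R θstar + ⟪z0, y - θstar⟫)) :=
        ((hL.continuous.tendsto _).comp hθU).add (hgU.inner (hθU.const_sub y))
      exact le_of_tendsto h1 (hpos.mono fun lam hl => hsub lam hl y)
    · have hH1 : Tendsto (fun lam => Hinv (g lam)) U (𝓝 (Hinv z0)) :=
        (Hinv.continuous.tendsto _).comp hgU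
      have h1 : Tendsto (fun lam : ℝ => lam⁻¹ • (θfun lam - θstar)) U (𝓝 (- Hinv z0)) := by
        have := (hv.mono_left hU).sub hH1
        simpa using this
      have h2 := (hgU.sub_const z).inner h1 (𝕜 := ℝ)
      have h3 : 0 ≤ ⟪z0 - z, - Hinv z0⟫ := by
        refine ge_of_tendsto h2 (hpos.mono fun lam hl => ?_)
        have ha := hsub lam hl θstar
        have hb := hz (θfun lam)
        rw [inner_smul_right]
        refine mul_nonneg (inv_nonneg.2 hl.le) ?_
        rw [← neg_sub, inner_neg_right] at ha
        rw [inner_sub_left]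
        linarith
      rw [inner_neg_right] at h3
      linarith
  have hmem : ∀ᶠ lam in 𝓝[>] (0:ℝ), g lam ∈ Metric.closedBall (0:E) L := by
    filter_upwards [self_mem_nhdsWithin] with lam hlam
    simpa using hbd lam hlam
  have hK : IsCompact (Metric.closedBall (0:E) L) := isCompact_closedBall _ _
  obtain ⟨z0, -, hz0⟩ := hK.exists_mapClusterPt (le_principal_iff.2 (mem_map.2 hmem))
  obtain ⟨hz0s, hz0m⟩ := hclus z0 hz0
  refine ⟨z0, hz0s, fun z hz => ?_, ?_⟩
  · have h1 := hz0m z hz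
    have h2 := hpsd' (z - z0)
    have h3 := hsymm' z z0
    simp only [map_sub, inner_sub_left, inner_sub_right] at h1 h2
    linarith
  · refine hK.tendsto_nhds_of_unique_mapClusterPt hmem ?_
    intro z1 _ hz1
    obtain ⟨hz1s, hz1m⟩ := hclus z1 hz1
    have h1 := hz0m z1 hz1s
    have h2 := hz1m z0 hz0s
    refine sub_eq_zero.1 (hpd _ ?_)
    simp only [map_sub, inner_sub_left, inner_sub_right] at h1 h2 ⊢
    linarith
end

section
/- Let X be a measurable space, let ν be a finite measure on X, let ρ : X → [0, ∞) be measurable and bounded, and let π̂ be the measure with density ρ with respect to ν (so π̂ is a finite measure absolutely continuous with respect to ν). Let q : X → ℝ be measurable and bounded. Then ∫ exp(q) dν − ∫ q dπ̂ ≥ ∫ |q| dπ̂ + 2·π̂(X) − 2·∫ log(2ρ) dπ̂ − ν(X). -/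
open MeasureTheory

theorem young_aux (a q : ℝ) (ha : 0 ≤ a) : a * q + a - a * Real.log a ≤ Real.exp q := by
  rcases ha.eq_or_lt with h | h
  · subst h; simpa using (Real.exp_pos q).le
  · have h1 := Real.add_one_le_exp (q - Real.log a)
    rw [Real.exp_sub, Real.exp_log h, le_div_iff₀ h] at h1
    nlinarith

theorem pt_aux (r q : ℝ) (hr : 0 ≤ r) :
    r * |q| + 2 * r - 2 * (r * Real.log (2 * r)) - 1 ≤ Real.exp q - r * q := by
  rcases le_total 0 q with h | h
  · rw [abs_of_nonneg h]
    have := young_aux (2 * r) q (by linarith)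
    nlinarith
  · rw [abs_of_nonpos h]
    have := young_aux (2 * r) 0 (by linarith)
    rw [Real.exp_zero] at this
    nlinarith [Real.exp_pos q]

/-- Lemma B.1 (lower bound for the entropic-dual functional): for π̂ = ρ·ν with
ρ bounded, ∫ e^q dν − ∫ q dπ̂ ≥ ∫ |q| dπ̂ + 2π̂(X) − 2∫ log(2ρ) dπ̂ − ν(X). -/
theorem entropic_dual_lower_bound
    {X : Type*} [MeasurableSpace X]
    (ν : Measure X) [IsFiniteMeasure ν]
    (ρ : X → ℝ) (hρmeas : Measurable ρ) (hρnonneg : ∀ x, 0 ≤ ρ x)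
    (Mρ : ℝ) (hρbd : ∀ x, ρ x ≤ Mρ)
    (πhat : Measure X)
    (hπ : πhat = ν.withDensity fun x => ENNReal.ofReal (ρ x))
    (q : X → ℝ) (hqmeas : Measurable q)
    (Mq : ℝ) (hqbd : ∀ x, |q x| ≤ Mq) :
    (∫ x, Real.exp (q x) ∂ν) - ∫ x, q x ∂πhat ≥
      (∫ x, |q x| ∂πhat) + 2 * (πhat Set.univ).toReal
        - 2 * (∫ x, Real.log (2 * ρ x) ∂πhat) - (ν Set.univ).toReal := by
  have hI : ∀ f : X → ℝ, ∫ x, f x ∂πhat = ∫ x, ρ x * f x ∂ν := by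
    intro f
    rw [hπ, integral_withDensity_eq_integral_toReal_smul hρmeas.ennreal_ofReal
      (Filter.Eventually.of_forall fun x => ENNReal.ofReal_lt_top)]
    simp [ENNReal.toReal_ofReal, hρnonneg]
  have hb : ∀ f : X → ℝ, Measurable f → ∀ C : ℝ, (∀ x, |f x| ≤ C) → Integrable f ν :=
    fun f hf C hC => Integrable.of_bound hf.aestronglyMeasurable C
      (Filter.Eventually.of_forall hC)
  have hu : (πhat Set.univ).toReal = ∫ x, ρ x ∂ν := by
    have := hI (fun _ => 1)
    simpa [Measure.real] using this
  have hn : (ν Set.univ).toReal = ∫ _x, (1:ℝ) ∂ν := by simp [Measure.real]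
  have hρa : ∀ x, |ρ x| ≤ Mρ := fun x => by rw [abs_of_nonneg (hρnonneg x)]; exact hρbd x
  have iρ : Integrable ρ ν := hb ρ hρmeas Mρ hρa
  have iq : Integrable (fun x => ρ x * q x) ν := by
    refine hb _ (hρmeas.mul hqmeas) (Mρ * Mq) fun x => ?_
    rw [abs_mul]
    exact mul_le_mul (hρa x) (hqbd x) (abs_nonneg _) ((abs_nonneg _).trans (hρa x))
  have iqa : Integrable (fun x => ρ x * |q x|) ν := by
    refine hb _ (hρmeas.mul hqmeas.abs) (Mρ * Mq) fun x => ?_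
    rw [abs_mul, abs_abs]
    exact mul_le_mul (hρa x) (hqbd x) (abs_nonneg _) ((abs_nonneg _).trans (hρa x))
  have ie : Integrable (fun x => Real.exp (q x)) ν := by
    refine hb _ hqmeas.exp (Real.exp Mq) fun x => ?_
    rw [abs_of_pos (Real.exp_pos _)]
    exact Real.exp_le_exp.2 ((le_abs_self _).trans (hqbd x))
  have il : Integrable (fun x => ρ x * Real.log (2 * ρ x)) ν := by
    obtain ⟨C, hC⟩ := (isCompact_Icc (a := (0:ℝ)) (b := 2 * Mρ)).exists_bound_of_continuousOn
      Real.continuous_mul_log.continuousOn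
    refine hb _ (hρmeas.mul (hρmeas.const_mul 2).log) (C / 2) fun x => ?_
    have := hC (2 * ρ x) ⟨by linarith [hρnonneg x], by linarith [hρbd x]⟩
    rw [Real.norm_eq_abs, mul_assoc, abs_mul, abs_two] at this
    linarith
  have key := integral_mono
    (((iqa.add (iρ.const_mul 2)).sub (il.const_mul 2)).sub (integrable_const (1:ℝ)))
    (ie.sub iq) (fun x => pt_aux (ρ x) (q x) (hρnonneg x))
  rw [integral_sub' ((iqa.add (iρ.const_mul 2)).sub (il.const_mul 2)) (integrable_const (1:ℝ)),
    integral_sub' (iqa.add (iρ.const_mul 2)) (il.const_mul 2),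
    integral_add' iqa (iρ.const_mul 2), integral_sub' ie iq,
    integral_const_mul, integral_const_mul] at key
  rw [hI, hI, hI, hu, hn]
  exact key
end

section
/- Let X be a measurable space, let μ be a finite measure on X, let η > 0 and M ≥ 0, and let h, h' : X → ℝ be measurable functions with |h(x)| ≤ M and |h'(x)| ≤ M for all x. Then η·∫ exp(h/η) dμ ≥ η·∫ exp(h'/η) dμ + ∫ exp(h'(x)/η)·(h(x) − h'(x)) dμ(x) + (exp(−M/η)/(2η))·∫ (h(x) − h'(x))² dμ(x). -/
open MeasureTheory

lemma aux_exp (t : ℝ) (ht : 0 ≤ t) : t ^ 2 / 2 ≤ Real.exp t * (t - 1) + 1 := by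
  have hd : ∀ x : ℝ, HasDerivAt (fun t : ℝ => Real.exp t * (t - 1) + 1 - t ^ 2 / 2)
      (x * (Real.exp x - 1)) x := by
    intro x
    have := (((Real.hasDerivAt_exp x).mul ((hasDerivAt_id x).sub_const 1)).add_const 1).sub
      (((hasDerivAt_id x).pow 2).div_const 2)
    refine HasDerivAt.congr_deriv this ?_
    simp
    ring
  have hm : MonotoneOn (fun t : ℝ => Real.exp t * (t - 1) + 1 - t ^ 2 / 2) (Set.Ici 0) := by
    apply monotoneOn_of_deriv_nonneg (convex_Ici 0)
    · exact fun x _ => (hd x).continuousAt.continuousWithinAt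
    · exact fun x _ => (hd x).differentiableAt.differentiableWithinAt
    · intro x hx
      rw [interior_Ici] at hx
      rw [(hd x).deriv]
      have hx' : 0 < x := hx
      have := Real.add_one_le_exp x
      exact mul_nonneg hx'.le (by linarith)
  have := hm (Set.mem_Ici.2 le_rfl) (Set.mem_Ici.2 ht) ht
  simp at this
  linarith

lemma aux_pt (a b m : ℝ) (ha : m ≤ a) (hb : m ≤ b) :
    Real.exp b + Real.exp b * (a - b) + Real.exp m / 2 * (a - b) ^ 2 ≤ Real.exp a := by
  rcases le_total b a with hab | hab
  · have h1 := Real.quadratic_le_exp_of_nonneg (sub_nonneg.2 hab)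
    have h2 : Real.exp a = Real.exp b * Real.exp (a - b) := by
      rw [← Real.exp_add]; congr 1; ring
    have h3 := mul_le_mul_of_nonneg_left h1 (Real.exp_pos b).le
    have h4 := mul_le_mul_of_nonneg_right (Real.exp_le_exp.2 hb) (sq_nonneg (a - b))
    rw [h2]
    linarith
  · have h1 := aux_exp (b - a) (sub_nonneg.2 hab)
    have h2 : Real.exp b = Real.exp a * Real.exp (b - a) := by
      rw [← Real.exp_add]; congr 1; ring
    have h3 := mul_le_mul_of_nonneg_left h1 (Real.exp_pos a).le
    have h4 := mul_le_mul_of_nonneg_right (Real.exp_le_exp.2 ha) (sq_nonneg (a - b))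
    rw [h2]
    linarith

/-- Lemma B.2 (strong convexity of the exponential integral functional): on
functions uniformly bounded by M, G(h) = η∫exp(h/η)dμ lies above its first
order expansion by a quadratic term with modulus exp(-M/η)/η. -/
theorem exp_integral_strong_convexity
    {X : Type*} [MeasurableSpace X]
    (μ : Measure X) [IsFiniteMeasure μ]
    (η M : ℝ) (hη : 0 < η) (hM : 0 ≤ M)
    (h h' : X → ℝ) (hhmeas : Measurable h) (hh'meas : Measurable h')
    (hhbd : ∀ x, |h x| ≤ M) (hh'bd : ∀ x, |h' x| ≤ M) :
    η * ∫ x, Real.exp (h x / η) ∂μ ≥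
      η * (∫ x, Real.exp (h' x / η) ∂μ)
        + (∫ x, Real.exp (h' x / η) * (h x - h' x) ∂μ)
        + (Real.exp (-M / η) / (2 * η)) * ∫ x, (h x - h' x) ^ 2 ∂μ := by
  have hb : ∀ f : X → ℝ, (∀ x, |f x| ≤ M) → ∀ x, Real.exp (f x / η) ≤ Real.exp (M / η) := by
    intro f hf x
    have := (abs_le.1 (hf x)).2
    gcongr
  have hd : ∀ x, |h x - h' x| ≤ 2 * M := fun x => by
    have := abs_sub (h x) (h' x)
    linarith [hhbd x, hh'bd x]
  have i1 : Integrable (fun x => Real.exp (h x / η)) μ := by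
    refine Integrable.of_bound (by fun_prop) (Real.exp (M / η)) (.of_forall fun x => ?_)
    simpa using hb h hhbd x
  have i2 : Integrable (fun x => Real.exp (h' x / η)) μ := by
    refine Integrable.of_bound (by fun_prop) (Real.exp (M / η)) (.of_forall fun x => ?_)
    simpa using hb h' hh'bd x
  have i3 : Integrable (fun x => Real.exp (h' x / η) * (h x - h' x)) μ := by
    refine Integrable.of_bound (by fun_prop) (Real.exp (M / η) * (2 * M)) (.of_forall fun x => ?_)
    rw [Real.norm_eq_abs, abs_mul, Real.abs_exp]
    exact mul_le_mul (hb h' hh'bd x) (hd x) (abs_nonneg _) (Real.exp_pos _).le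
  have i4 : Integrable (fun x => (h x - h' x) ^ 2) μ := by
    refine Integrable.of_bound (by fun_prop) ((2 * M) ^ 2) (.of_forall fun x => ?_)
    rw [Real.norm_eq_abs, abs_pow]
    exact pow_le_pow_left₀ (abs_nonneg _) (hd x) 2
  have i5 : Integrable (fun x => η * Real.exp (h' x / η)
      + Real.exp (h' x / η) * (h x - h' x)) μ := (i2.const_mul η).add i3
  rw [ge_iff_le, ← integral_const_mul, ← integral_const_mul, ← integral_const_mul,
    ← integral_add (i2.const_mul η) i3,
    ← integral_add i5 (i4.const_mul _)]
  refine integral_mono (i5.add (i4.const_mul _)) (i1.const_mul η) ?_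
  intro x
  have h1 := aux_pt (h x / η) (h' x / η) (-M / η)
    (by have := (abs_le.1 (hhbd x)).1; gcongr) (by have := (abs_le.1 (hh'bd x)).1; gcongr)
  have h2 := mul_le_mul_of_nonneg_left h1 hη.le
  refine le_trans (le_of_eq ?_) h2
  simp only [Pi.add_apply]
  field_simp
end

section
/- For all η > 0, r > 0, C ≥ 0, m_α > 0, m_β > 0 and μ > 0, there exists δ > 0 with the following property. Let n ≥ 1, let c : {1,…,n} × {1,…,n} → ℝ satisfy |c_{ij}| ≤ C for all i, j, let ψ₁ : ℝ → ℝ be convex and μ-strongly convex on the interval [−r, r], and let ψ₂ : ℝ → ℝ be convex. Define K̂ₙ on pairs of vectors (f, g) ∈ ℝⁿ × ℝⁿ by K̂ₙ(f, g) := (1/n²)·Σ_{i,j} [ m_α·ψ₁(−f_i) + m_β·ψ₂(−g_j) + m_α·m_β·exp((f_i + g_j − c_{ij})/η) ]. Then for all (f, g) and (f', g') with |f_i|, |g_i|, |f'_i|, |g'_i| ≤ r for every i, and all t ∈ [0, 1]: K̂ₙ(t f + (1−t) f', t g + (1−t) g') ≤ t·K̂ₙ(f, g) + (1−t)·K̂ₙ(f',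 g') − (δ/n)·(t(1−t)/2)·( Σ_i (f_i − f'_i)² + Σ_i (g_i − g'_i)² ). -/
open scoped BigOperators

/-- The empirical dual function of entropic unbalanced optimal transport with
`n`-atom empirical marginals of masses `mα`, `mβ`. -/
noncomputable def KhatUOT {n : ℕ} (mα mβ η : ℝ) (ψ₁ ψ₂ : ℝ → ℝ)
    (c : Fin n → Fin n → ℝ) (f g : Fin n → ℝ) : ℝ :=
  (1 / (n : ℝ) ^ 2) *
    ∑ i : Fin n, ∑ j : Fin n,
      (mα * ψ₁ (-(f i)) + mβ * ψ₂ (-(g j))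
        + mα * mβ * Real.exp ((f i + g j - c i j) / η))

lemma uot_aux_exp (M x y t : ℝ) (hx : -M ≤ x) (hy : -M ≤ y) (ht0 : 0 ≤ t) (ht1 : t ≤ 1) :
    Real.exp (t * x + (1 - t) * y) ≤ t * Real.exp x + (1 - t) * Real.exp y
      - Real.exp (-M) / 2 * (t * (1 - t)) * (x - y) ^ 2 := by
  have hd : ∀ z : ℝ, HasDerivAt (fun z : ℝ => Real.exp z - Real.exp (-M) / 2 * z ^ 2)
      (Real.exp z - Real.exp (-M) * z) z := by
    intro z
    have h := (Real.hasDerivAt_exp z).sub (((hasDerivAt_id z).pow 2).const_mul (Real.exp (-M) / 2))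
    refine h.congr_deriv ?_
    simp
    ring
  have hd2 : ∀ z : ℝ, HasDerivAt (fun z : ℝ => Real.exp z - Real.exp (-M) * z)
      (Real.exp z - Real.exp (-M)) z := by
    intro z
    have h := (Real.hasDerivAt_exp z).sub ((hasDerivAt_id z).const_mul (Real.exp (-M)))
    refine h.congr_deriv ?_
    simp
  have hc : ConvexOn ℝ (Set.Ici (-M)) (fun z : ℝ => Real.exp z - Real.exp (-M) / 2 * z ^ 2) := by
    apply convexOn_of_hasDerivWithinAt2_nonneg (convex_Ici _) (by fun_prop)
      (fun z _ => (hd z).hasDerivWithinAt) (fun z _ => (hd2 z).hasDerivWithinAt)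
    intro z hz
    rw [interior_Ici] at hz
    have := Real.exp_le_exp.mpr (le_of_lt hz)
    linarith
  have h := hc.2 hx hy ht0 (sub_nonneg.mpr ht1) (by ring)
  simp only [smul_eq_mul] at h
  nlinarith [h]

/-- Proposition C.4 (local strong convexity of the empirical UOT dual): there
is δ > 0, depending only on (η, r, C, m_α, m_β, μ), such that for every n, every
cost matrix bounded by C, every convex ψ₁ that is μ-strongly convex on [-r, r],
and every convex ψ₂, the empirical dual K̂ₙ is (δ/n)-strongly convex on the box
of vectors bounded by r. -/
theorem empirical_uot_dual_local_strong_convexity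
    (η r C mα mβ μ : ℝ) (hη : 0 < η) (hr : 0 < r) (hC : 0 ≤ C)
    (hmα : 0 < mα) (hmβ : 0 < mβ) (hμ : 0 < μ) :
    ∃ δ > (0 : ℝ), ∀ (n : ℕ), 1 ≤ n →
      ∀ (c : Fin n → Fin n → ℝ), (∀ i j, |c i j| ≤ C) →
      ∀ (ψ₁ ψ₂ : ℝ → ℝ),
        ConvexOn ℝ Set.univ ψ₁ →
        (∀ x ∈ Set.Icc (-r) r, ∀ y ∈ Set.Icc (-r) r, ∀ t : ℝ, 0 ≤ t → t ≤ 1 →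
          ψ₁ (t * x + (1 - t) * y) ≤
            t * ψ₁ x + (1 - t) * ψ₁ y - μ / 2 * t * (1 - t) * (x - y) ^ 2) →
        ConvexOn ℝ Set.univ ψ₂ →
      ∀ (f g f' g' : Fin n → ℝ),
        (∀ i, |f i| ≤ r) → (∀ i, |g i| ≤ r) →
        (∀ i, |f' i| ≤ r) → (∀ i, |g' i| ≤ r) →
      ∀ t : ℝ, 0 ≤ t → t ≤ 1 →
        KhatUOT mα mβ η ψ₁ ψ₂ c
            (fun i => t * f i + (1 - t) * f' i)
            (fun i => t * g i + (1 - t) * g' i) ≤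
          t * KhatUOT mα mβ η ψ₁ ψ₂ c f g
            + (1 - t) * KhatUOT mα mβ η ψ₁ ψ₂ c f' g'
            - (δ / n) * (t * (1 - t) / 2) *
              ((∑ i : Fin n, (f i - f' i) ^ 2) + ∑ i : Fin n, (g i - g' i) ^ 2) := by
  set M : ℝ := (2 * r + C) / η with hM
  set A : ℝ := mα * μ with hA
  set B : ℝ := mα * mβ * Real.exp (-M) / η ^ 2 with hB
  have hA0 : 0 < A := by positivity
  have hB0 : 0 < B := by positivity
  refine ⟨min A B / 3, by positivity, ?_⟩
  intro n hn c hc ψ₁ ψ₂ _ h1 h2 f g f' g' hf hg hf' hg' t ht0 ht1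
  have hn0 : (0 : ℝ) < n := by exact_mod_cast hn
  set D : ℝ := min A B / 3 with hD
  have hDA : D ≤ A / 3 := by
    have := min_le_left A B
    linarith
  have hDB : D ≤ B / 3 := by
    have := min_le_right A B
    linarith
  have hs : 0 ≤ t * (1 - t) := mul_nonneg ht0 (sub_nonneg.mpr ht1)
  have key : ∀ i j : Fin n,
      mα * ψ₁ (-(t * f i + (1 - t) * f' i)) + mβ * ψ₂ (-(t * g j + (1 - t) * g' j))
        + mα * mβ * Real.exp ((t * f i + (1 - t) * f' i + (t * g j + (1 - t) * g' j) - c i j) / η)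
      ≤ t * (mα * ψ₁ (-(f i)) + mβ * ψ₂ (-(g j))
          + mα * mβ * Real.exp ((f i + g j - c i j) / η))
        + (1 - t) * (mα * ψ₁ (-(f' i)) + mβ * ψ₂ (-(g' j))
          + mα * mβ * Real.exp ((f' i + g' j - c i j) / η))
        - D * (t * (1 - t) / 2) * ((f i - f' i) ^ 2 + (g j - g' j) ^ 2) := by
    intro i j
    have bf := abs_le.mp (hf i)
    have bf' := abs_le.mp (hf' i)
    have bg := abs_le.mp (hg j)
    have bg' := abs_le.mp (hg' j)
    have bc := abs_le.mp (hc i j)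
    have e1 := h1 (-(f i)) ⟨by linarith, by linarith⟩ (-(f' i)) ⟨by linarith, by linarith⟩ t ht0 ht1
    have e2 := h2.2 (Set.mem_univ (-(g j))) (Set.mem_univ (-(g' j))) ht0 (sub_nonneg.mpr ht1)
      (by ring)
    simp only [smul_eq_mul] at e2
    have e3 := uot_aux_exp M ((f i + g j - c i j) / η) ((f' i + g' j - c i j) / η) t
      (by rw [hM, ← neg_div]; gcongr; linarith) (by rw [hM, ← neg_div]; gcongr; linarith) ht0 ht1
    have r1 : t * -(f i) + (1 - t) * -(f' i) = -(t * f i + (1 - t) * f' i) := by ring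
    have r2 : t * -(g j) + (1 - t) * -(g' j) = -(t * g j + (1 - t) * g' j) := by ring
    have r3 : t * ((f i + g j - c i j) / η) + (1 - t) * ((f' i + g' j - c i j) / η)
        = (t * f i + (1 - t) * f' i + (t * g j + (1 - t) * g' j) - c i j) / η := by ring
    rw [r1] at e1
    rw [r2] at e2
    rw [r3] at e3
    have q1 := mul_le_mul_of_nonneg_left e1 hmα.le
    have q2 := mul_le_mul_of_nonneg_left e2 hmβ.le
    have q3 := mul_le_mul_of_nonneg_left e3 (mul_pos hmα hmβ).le
    have r4 : mα * mβ * (Real.exp (-M) / 2 * (t * (1 - t)) *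
        ((f i + g j - c i j) / η - (f' i + g' j - c i j) / η) ^ 2)
        = t * (1 - t) / 2 * (B * ((f i - f' i) + (g j - g' j)) ^ 2) := by
      rw [hB]; ring
    have r5 : mα * (μ / 2 * t * (1 - t) * (-(f i) - -(f' i)) ^ 2)
        = t * (1 - t) / 2 * (A * (f i - f' i) ^ 2) := by
      rw [hA]; ring
    have q : D * ((f i - f' i) ^ 2 + (g j - g' j) ^ 2)
        ≤ A * (f i - f' i) ^ 2 + B * ((f i - f' i) + (g j - g' j)) ^ 2 := by
      generalize f i - f' i = a
      generalize g j - g' j = b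
      have hD0 : 0 < D := by positivity
      have p1 : a ^ 2 + b ^ 2 ≤ 3 * a ^ 2 + 3 * (a + b) ^ 2 := by
        clear * -
        nlinarith [sq_nonneg (2 * b + 3 * a), sq_nonneg a]
      have p2 := mul_le_mul_of_nonneg_left p1 hD0.le
      have p3 := mul_le_mul_of_nonneg_right hDA (sq_nonneg a)
      have p4 := mul_le_mul_of_nonneg_right hDB (sq_nonneg (a + b))
      linarith
    have q' := mul_le_mul_of_nonneg_left q (by linarith : (0 : ℝ) ≤ t * (1 - t) / 2)
    rw [mul_sub, r5] at q1
    rw [mul_sub, r4] at q3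
    linarith
  have hsum := Finset.sum_le_sum fun i (_ : i ∈ (Finset.univ : Finset (Fin n))) =>
    Finset.sum_le_sum fun j (_ : j ∈ (Finset.univ : Finset (Fin n))) => key i j
  have hsq : ∑ i : Fin n, ∑ j : Fin n, ((f i - f' i) ^ 2 + (g j - g' j) ^ 2)
      = n * ((∑ i : Fin n, (f i - f' i) ^ 2) + ∑ i : Fin n, (g i - g' i) ^ 2) := by
    simp only [Finset.sum_add_distrib, Finset.sum_const, Finset.card_univ, Fintype.card_fin,
      nsmul_eq_mul, ← Finset.mul_sum]
    ring
  have hsplit : ∀ (F G H : Fin n → Fin n → ℝ) (k : ℝ),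
      ∑ i, ∑ j, (t * F i j + (1 - t) * G i j - k * H i j)
        = t * ∑ i, ∑ j, F i j + (1 - t) * ∑ i, ∑ j, G i j - k * ∑ i, ∑ j, H i j := by
    intro F G H k
    simp only [Finset.sum_add_distrib, Finset.sum_sub_distrib, Finset.mul_sum]
  rw [hsplit, hsq] at hsum
  have hfin := mul_le_mul_of_nonneg_left hsum (by positivity : (0 : ℝ) ≤ 1 / (n : ℝ) ^ 2)
  unfold KhatUOT
  refine hfin.trans (le_of_eq ?_)
  field_simp
end

section
/- Let X and Y be measurable spaces and let ξ be a probability measure on X × Y with marginals ᾱ := (first-coordinate pushforward of ξ) and β̄ := (second-coordinate pushforward of ξ). Let h : X × Y → ℝ be measurable (for the product sigma-algebra) with |h| ≤ B everywhere and with ∫ h d(ᾱ ⊗ β̄) = 0. Let n ≥ 1 and consider n i.i.d. samples (z₁, w₁), …, (zₙ, wₙ) from ξ, i.e. the product measure ξ^{⊗n} on (X × Y)ⁿ. Then the U-statistic Uₙ := (1/n²)·Σ_{i=1}^n Σ_{j=1}^n h(z_i, w_j) satisfies E[Uₙ²] ≤ 6B²/n, where the expectation is with respect to ξ^{⊗n}.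 -/
open MeasureTheory
open scoped BigOperators

lemma ustat_term_bound
    {X Y : Type*} [MeasurableSpace X] [MeasurableSpace Y]
    (ξ : Measure (X × Y)) [IsProbabilityMeasure ξ]
    (h : X × Y → ℝ) (hmeas : Measurable h)
    (B : ℝ) (hB : ∀ p, |h p| ≤ B)
    (hcentered : ∫ p, h p ∂((ξ.map Prod.fst).prod (ξ.map Prod.snd)) = 0)
    (n : ℕ) (i j k l : Fin n) :
    (∫ ω : Fin n → X × Y, h ((ω i).1, (ω j).2) * h ((ω k).1, (ω l).2)
      ∂(Measure.pi fun _ : Fin n => ξ)) ≤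
      B ^ 2 * ((if i = j then 1 else 0) + (if i = k then 1 else 0) + (if i = l then 1 else 0)
        + (if j = k then 1 else 0) + (if j = l then 1 else 0) + (if k = l then 1 else 0)) := by
  set P : Measure (Fin n → X × Y) := Measure.pi fun _ : Fin n => ξ with hP
  have hind : ProbabilityTheory.iIndepFun (fun (i : Fin n) (ω : Fin n → X × Y) => ω i) P :=
    ProbabilityTheory.iIndepFun_pi (μ := fun _ : Fin n => ξ) (X := fun _ x => x)
      (fun _ => aemeasurable_id)
  by_cases hd : i ≠ j ∧ i ≠ k ∧ i ≠ l ∧ j ≠ k ∧ j ≠ l ∧ k ≠ l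
  · obtain ⟨hij, hik, hil, hjk, hjl, hkl⟩ := hd
    have h1 := hind.indepFun_prodMk_prodMk (fun i => measurable_pi_apply i) i j k l hik hil hjk hjl
    have hg : Measurable (fun p : (X × Y) × (X × Y) => h (p.1.1, p.2.2)) := by fun_prop
    have h2 := h1.comp hg hg
    have h3 := h2.integral_fun_mul_eq_mul_integral
      (hg.comp (by fun_prop)).aestronglyMeasurable (hg.comp (by fun_prop)).aestronglyMeasurable
    have h4 : ∫ ω, h ((ω i).1, (ω j).2) ∂P = 0 := by
      have h5 := (hind.indepFun hij).comp (φ := Prod.fst) (ψ := Prod.snd)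
        measurable_fst measurable_snd
      have h6 := (ProbabilityTheory.indepFun_iff_map_prod_eq_prod_map_map
        (measurable_fst.comp (measurable_pi_apply i)).aemeasurable
        (measurable_snd.comp (measurable_pi_apply j)).aemeasurable).1 h5
      have ev : ∀ i : Fin n, P.map (fun ω => ω i) = ξ := fun i =>
        (measurePreserving_eval (fun _ : Fin n => ξ) i).map_eq
      rw [← Measure.map_map measurable_fst (measurable_pi_apply i),
        ← Measure.map_map measurable_snd (measurable_pi_apply j), ev, ev] at h6
      rw [← h6, integral_map ((measurable_fst.comp (measurable_pi_apply i)).prodMk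
        (measurable_snd.comp (measurable_pi_apply j))).aemeasurable
        hmeas.aestronglyMeasurable] at hcentered
      exact hcentered
    simp only [Function.comp_def] at h3
    rw [h3, h4]
    simp [hij, hik, hil, hjk, hjl, hkl]
  · have h7 : (∫ ω, h ((ω i).1, (ω j).2) * h ((ω k).1, (ω l).2) ∂P) ≤ B ^ 2 := by
      refine (le_abs_self _).trans ?_
      have := norm_integral_le_of_norm_le_const (μ := P) (C := B ^ 2)
        (f := fun ω => h ((ω i).1, (ω j).2) * h ((ω k).1, (ω l).2))
        (Filter.Eventually.of_forall fun ω => by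
          rw [norm_mul, sq]
          exact mul_le_mul (hB _) (hB _) (norm_nonneg _) ((abs_nonneg _).trans (hB ((ω i).1, (ω j).2))))
      simpa using this
    refine h7.trans (le_mul_of_one_le_right (sq_nonneg _) ?_)
    clear h7 hind hP hcentered hB hmeas
    split_ifs <;> first | (norm_num; done) | (exact absurd ⟨‹_›, ‹_›, ‹_›, ‹_›, ‹_›, ‹_›⟩ hd)

/-- Second-moment bound for the U-statistic in Lemma D.1: if h is bounded by B
and centered with respect to the product of the marginals of ξ, then
E[Uₙ²] ≤ 6B²/n for Uₙ = (1/n²)·Σᵢⱼ h(zᵢ, wⱼ) with (zᵢ, wᵢ) i.i.d. from ξ. -/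
theorem ustatistic_second_moment_bound
    {X Y : Type*} [MeasurableSpace X] [MeasurableSpace Y]
    (ξ : Measure (X × Y)) [IsProbabilityMeasure ξ]
    (h : X × Y → ℝ) (hmeas : Measurable h)
    (B : ℝ) (hB : ∀ p, |h p| ≤ B)
    (hcentered : ∫ p, h p ∂((ξ.map Prod.fst).prod (ξ.map Prod.snd)) = 0)
    (n : ℕ) (hn : 1 ≤ n) :
    (∫ ω : Fin n → X × Y,
        ((1 / (n : ℝ) ^ 2) *
          ∑ i : Fin n, ∑ j : Fin n, h ((ω i).1, (ω j).2)) ^ 2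
      ∂(Measure.pi fun _ : Fin n => ξ)) ≤ 6 * B ^ 2 / n := by
  have hn0 : (0 : ℝ) < n := by exact_mod_cast hn
  have hint : ∀ i j k l : Fin n, Integrable
      (fun ω : Fin n → X × Y => h ((ω i).1, (ω j).2) * h ((ω k).1, (ω l).2))
      (Measure.pi fun _ : Fin n => ξ) := by
    intro i j k l
    refine Integrable.of_bound (C := B ^ 2) (by fun_prop)
      (Filter.Eventually.of_forall fun ω => ?_)
    rw [norm_mul, sq]
    exact mul_le_mul (hB _) (hB _) (norm_nonneg _) ((abs_nonneg _).trans (hB ((ω i).1, (ω j).2)))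
  have hexp : ∀ ω : Fin n → X × Y,
      ((1 / (n : ℝ) ^ 2) * ∑ i : Fin n, ∑ j : Fin n, h ((ω i).1, (ω j).2)) ^ 2
      = (1 / (n : ℝ) ^ 4) * ∑ i : Fin n, ∑ j : Fin n, ∑ k : Fin n, ∑ l : Fin n,
        h ((ω i).1, (ω j).2) * h ((ω k).1, (ω l).2) := by
    intro ω
    have : (∑ i : Fin n, ∑ j : Fin n, h ((ω i).1, (ω j).2)) ^ 2
      = ∑ i : Fin n, ∑ j : Fin n, ∑ k : Fin n, ∑ l : Fin n,
        h ((ω i).1, (ω j).2) * h ((ω k).1, (ω l).2) := by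
      rw [sq]
      simp only [Finset.sum_mul, ← Finset.mul_sum]
    rw [mul_pow, this]
    congr 1
    rw [div_pow, one_pow, ← pow_mul]
  simp_rw [hexp]
  rw [integral_const_mul]
  have hsum : (∫ ω : Fin n → X × Y, ∑ i : Fin n, ∑ j : Fin n, ∑ k : Fin n, ∑ l : Fin n,
        h ((ω i).1, (ω j).2) * h ((ω k).1, (ω l).2) ∂(Measure.pi fun _ : Fin n => ξ))
      = ∑ i : Fin n, ∑ j : Fin n, ∑ k : Fin n, ∑ l : Fin n,
        ∫ ω : Fin n → X × Y, h ((ω i).1, (ω j).2) * h ((ω k).1, (ω l).2)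
          ∂(Measure.pi fun _ : Fin n => ξ) := by
    rw [integral_finsetSum _ fun i _ => integrable_finsetSum _ fun j _ =>
      integrable_finsetSum _ fun k _ => integrable_finsetSum _ fun l _ => hint i j k l]
    refine Finset.sum_congr rfl fun i _ => ?_
    rw [integral_finsetSum _ fun j _ =>
      integrable_finsetSum _ fun k _ => integrable_finsetSum _ fun l _ => hint i j k l]
    refine Finset.sum_congr rfl fun j _ => ?_
    rw [integral_finsetSum _ fun k _ => integrable_finsetSum _ fun l _ => hint i j k l]
    refine Finset.sum_congr rfl fun k _ => ?_
    rw [integral_finsetSum _ fun l _ => hint i j k l]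
  have hle : (∑ i : Fin n, ∑ j : Fin n, ∑ k : Fin n, ∑ l : Fin n,
        ∫ ω : Fin n → X × Y, h ((ω i).1, (ω j).2) * h ((ω k).1, (ω l).2)
          ∂(Measure.pi fun _ : Fin n => ξ)) ≤ B ^ 2 * (6 * (n : ℝ) ^ 3) := by
    refine (Finset.sum_le_sum fun i _ => Finset.sum_le_sum fun j _ => Finset.sum_le_sum fun k _ =>
      Finset.sum_le_sum fun l _ =>
        ustat_term_bound ξ h hmeas B hB hcentered n i j k l).trans (le_of_eq ?_)
    simp only [← Finset.mul_sum]
    congr 1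
    simp [Finset.sum_add_distrib, Finset.sum_ite_eq, Finset.sum_const]
    ring
  rw [hsum]
  calc _ ≤ 1 / (n : ℝ) ^ 4 * (B ^ 2 * (6 * (n : ℝ) ^ 3)) := by gcongr
    _ = _ := by field_simp
end

section
/- Let X and Y be measurable spaces and let ξ be a probability measure on X × Y with marginals ᾱ := (first-coordinate pushforward of ξ) and β̄ := (second-coordinate pushforward of ξ). Let h : X × Y → ℝ be measurable (for the product sigma-algebra) with |h| ≤ B everywhere, where B > 0, and with ∫ h d(ᾱ ⊗ β̄) = 0. Let n ≥ 1, let (z₁, w₁), …, (zₙ, wₙ) be n i.i.d. samples from ξ (i.e. distributed according to the product measure ξ^{⊗n}), and set Uₙ := (1/n²)·Σ_{i=1}^n Σ_{j=1}^n h(z_i, w_j). Then for every s > 0, the probability that |Uₙ| ≥ √6·B/√n + s is at most 2·exp(−n·s²/(8B²)). -/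
open MeasureTheory
open scoped BigOperators

theorem ust_cons {Z : Type*} [MeasurableSpace Z] (ξ : Measure Z) [IsProbabilityMeasure ξ] (n : ℕ)
    (F : (Fin (n+1) → Z) → ℝ) :
    ∫ ω, F ω ∂(Measure.pi fun _ : Fin (n+1) => ξ) =
      ∫ p : Z × (Fin n → Z), F (Fin.cons p.1 p.2) ∂(ξ.prod (Measure.pi fun _ : Fin n => ξ)) := by
  rw [← ((measurePreserving_piFinSuccAbove (fun _ : Fin (n+1) => ξ) 0).symm).integral_comp']
  simp_rw [MeasurableEquiv.piFinSuccAbove_symm_apply, Fin.insertNthEquiv, Equiv.coe_fn_mk,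
    Fin.insertNth_zero]
  rfl

theorem ust_meas_cons {Z : Type*} [MeasurableSpace Z] (n : ℕ) :
    Measurable (fun p : Z × (Fin n → Z) => (Fin.cons p.1 p.2 : Fin (n+1) → Z)) := by
  refine measurable_pi_iff.2 (Fin.cases ?_ fun j => ?_)
  · simpa using measurable_fst
  · simp only [Fin.cons_succ]
    exact (measurable_pi_apply j).comp measurable_snd

theorem ust_int_bdd {Z : Type*} [MeasurableSpace Z] (μ : Measure Z) [IsFiniteMeasure μ]
    (F : Z → ℝ) (hF : Measurable F) (M : ℝ) (hM : ∀ z, |F z| ≤ M) : Integrable F μ :=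
  Integrable.of_bound hF.aestronglyMeasurable M (Filter.Eventually.of_forall hM)

theorem ust_int_exp {Z : Type*} [MeasurableSpace Z] (μ : Measure Z) [IsFiniteMeasure μ]
    (F : Z → ℝ) (hF : Measurable F) (M : ℝ) (hM : ∀ z, |F z| ≤ M) (t : ℝ) :
    Integrable (fun z => Real.exp (t * F z)) μ := by
  refine ust_int_bdd μ _ (by fun_prop) (Real.exp (|t| * M)) fun z => ?_
  rw [abs_of_pos (Real.exp_pos _), Real.exp_le_exp]
  calc t * F z ≤ |t * F z| := le_abs_self _
    _ = |t| * |F z| := abs_mul _ _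
    _ ≤ _ := by gcongr; exact hM z

theorem ust_hoeff {Z : Type*} [MeasurableSpace Z] (ξ : Measure Z) [IsProbabilityMeasure ξ]
    (F : Z → ℝ) (hF : Measurable F) (M : ℝ) (hM : ∀ z, |F z| ≤ M) (c : ℝ)
    (hc : ∀ z z', |F z - F z'| ≤ c) (t : ℝ) :
    ∫ z, Real.exp (t * F z) ∂ξ ≤ Real.exp (t * ∫ z, F z ∂ξ + t ^ 2 * c ^ 2 / 8) := by
  have : Nonempty Z := nonempty_of_isProbabilityMeasure ξ
  have hbd : BddBelow (Set.range F) := ⟨-M, by rintro _ ⟨z, rfl⟩; exact (abs_le.1 (hM z)).1⟩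
  have h1 : ∀ z, F z ∈ Set.Icc (⨅ z, F z) ((⨅ z, F z) + c) := fun z => by
    refine ⟨ciInf_le hbd z, ?_⟩
    have : F z - c ≤ ⨅ z, F z := le_ciInf fun z' => by
      have := (abs_le.1 (hc z z')).2
      linarith
    linarith
  have h2 := (ProbabilityTheory.hasSubgaussianMGF_of_mem_Icc (μ := ξ) hF.aemeasurable
    (Filter.Eventually.of_forall h1)).mgf_le t
  simp only [ProbabilityTheory.mgf, mul_sub, Real.exp_sub] at h2
  rw [integral_div, div_le_iff₀ (Real.exp_pos _), ← Real.exp_add] at h2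
  refine h2.trans (le_of_eq ?_)
  congr 1
  simp [div_pow]
  ring

theorem ust_mgf {Z : Type*} [MeasurableSpace Z] (ξ : Measure Z) [IsProbabilityMeasure ξ]
    (M c t : ℝ) (n : ℕ) :
    ∀ (F : (Fin n → Z) → ℝ), Measurable F → (∀ z, |F z| ≤ M) →
    (∀ k ω ω', (∀ i, i ≠ k → ω i = ω' i) → |F ω - F ω'| ≤ c) →
    ∫ ω, Real.exp (t * F ω) ∂(Measure.pi fun _ : Fin n => ξ) ≤
      Real.exp (t * ∫ ω, F ω ∂(Measure.pi fun _ : Fin n => ξ) + n * (t ^ 2 * c ^ 2 / 8)) := by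
  induction n with
  | zero => 
    intro F _ _ _
    obtain ⟨a, rfl⟩ : ∃ a, F = fun _ => a :=
      ⟨F Fin.elim0, funext fun ω => congrArg F (Subsingleton.elim _ _)⟩
    simp
  | succ n ih =>
    intro F hF hM hc
    have hFc : Measurable (fun p : Z × (Fin n → Z) => F (Fin.cons p.1 p.2)) :=
      hF.comp (ust_meas_cons n)
    have hFz : ∀ ω, Measurable (fun z : Z => F (Fin.cons z ω)) := fun ω =>
      hFc.comp (measurable_id.prodMk measurable_const)
    have hFω : ∀ z, Measurable (fun ω : Fin n → Z => F (Fin.cons z ω)) := fun z =>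
      hFc.comp (measurable_const.prodMk measurable_id)
    set G : (Fin n → Z) → ℝ := fun ω => ∫ z, F (Fin.cons z ω) ∂ξ with hG
    have hGm : Measurable G :=
      (hFc.stronglyMeasurable.integral_prod_left').measurable
    have hGM : ∀ ω, |G ω| ≤ M := fun ω => by
      have := norm_integral_le_of_norm_le_const (μ := ξ) (f := fun z => F (Fin.cons z ω)) (C := M)
        (Filter.Eventually.of_forall fun z => hM _)
      simpa using this
    have hGc : ∀ k ω ω', (∀ i, i ≠ k → ω i = ω' i) → |G ω - G ω'| ≤ c := fun k ω ω' hk => by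
      rw [hG]
      simp only
      rw [← integral_sub (ust_int_bdd _ _ (hFz ω) M fun _ => hM _)
        (ust_int_bdd _ _ (hFz ω') M fun _ => hM _)]
      have := norm_integral_le_of_norm_le_const (μ := ξ)
        (f := fun z => F (Fin.cons z ω) - F (Fin.cons z ω')) (C := c)
        (Filter.Eventually.of_forall fun z => hc k.succ _ _ (Fin.cases (by simp) fun j hj => by
          simpa using hk j (by simpa using hj)))
      simpa using this
    have hIH := ih G hGm hGM hGc
    rw [ust_cons, ust_cons]
    rw [integral_prod_symm _ (ust_int_bdd _ _ hFc M fun _ => hM _),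
      integral_prod_symm _ (ust_int_exp _ _ hFc M (fun _ => hM _) t)]
    have step : ∀ ω, ∫ z, Real.exp (t * F (Fin.cons z ω)) ∂ξ ≤
        Real.exp (t * G ω) * Real.exp (t ^ 2 * c ^ 2 / 8) := fun ω => by
      rw [← Real.exp_add]
      exact ust_hoeff ξ _ (hFz ω) M (fun _ => hM _) c (fun z z' => hc 0 _ _
        (Fin.cases (by simp) fun j _ => by simp)) t
    calc _ ≤ ∫ ω, Real.exp (t * G ω) * Real.exp (t ^ 2 * c ^ 2 / 8)
            ∂(Measure.pi fun _ : Fin n => ξ) := by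
          refine integral_mono (ust_int_exp _ _ hFc M (fun _ => hM _) t).integral_prod_right
            ((ust_int_exp _ _ hGm M hGM t).mul_const _) step
      _ ≤ _ := by
          rw [integral_mul_const]
          refine (mul_le_mul_of_nonneg_right hIH (Real.exp_pos _).le).trans (le_of_eq ?_)
          rw [← Real.exp_add]
          congr 1
          push_cast
          ring

theorem ust_mcdiarmid {Z : Type*} [MeasurableSpace Z] (ξ : Measure Z) [IsProbabilityMeasure ξ]
    (M c : ℝ) (n : ℕ) (F : (Fin n → Z) → ℝ) (hF : Measurable F) (hM : ∀ z, |F z| ≤ M)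
    (hc : ∀ k ω ω', (∀ i, i ≠ k → ω i = ω' i) → |F ω - F ω'| ≤ c) (s : ℝ) (hs : 0 ≤ s) :
    (Measure.pi fun _ : Fin n => ξ).real
      {ω | s ≤ F ω - ∫ ω, F ω ∂(Measure.pi fun _ : Fin n => ξ)} ≤
      Real.exp (- s ^ 2 / (2 * (n * c ^ 2 / 4))) := by
  set m := ∫ ω, F ω ∂(Measure.pi fun _ : Fin n => ξ) with hm
  have H : ProbabilityTheory.HasSubgaussianMGF (fun ω => F ω - m)
      (Real.toNNReal (n * c ^ 2 / 4)) (Measure.pi fun _ : Fin n => ξ) := by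
    refine ⟨fun t => ust_int_exp _ _ (by fun_prop) (M + |m|)
      (fun z => (abs_sub _ _).trans (by gcongr; exact hM z)) t, fun t => ?_⟩
    have := ust_mgf ξ M c t n F hF hM hc
    simp only [ProbabilityTheory.mgf, mul_sub, Real.exp_sub]
    rw [integral_div, div_le_iff₀ (Real.exp_pos _), ← Real.exp_add]
    refine this.trans (le_of_eq ?_)
    rw [Real.coe_toNNReal _ (by positivity)]
    congr 1
    ring
  have := H.measure_ge_le hs
  rwa [Real.coe_toNNReal _ (by positivity)] at this

theorem ust_mean {X Y : Type*} [MeasurableSpace X] [MeasurableSpace Y]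
    (ξ : Measure (X × Y)) [IsProbabilityMeasure ξ]
    (h : X × Y → ℝ) (hmeas : Measurable h)
    (hcentered : ∫ p, h p ∂((ξ.map Prod.fst).prod (ξ.map Prod.snd)) = 0)
    (n : ℕ) (i j : Fin n) (hij : i ≠ j) :
    ∫ ω, h ((ω i).1, (ω j).2) ∂(Measure.pi fun _ : Fin n => ξ) = 0 := by
  have hind : ProbabilityTheory.iIndepFun (fun (i : Fin n) (ω : Fin n → X × Y) => ω i)
      (Measure.pi fun _ : Fin n => ξ) :=
    ProbabilityTheory.iIndepFun_pi (X := fun _ => id) (fun _ => aemeasurable_id)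
  have h1 := (ProbabilityTheory.indepFun_iff_map_prod_eq_prod_map_map
    (measurable_pi_apply i).aemeasurable (measurable_pi_apply j).aemeasurable).1 (hind.indepFun hij)
  rw [(measurePreserving_eval (fun _ : Fin n => ξ) i).map_eq,
    (measurePreserving_eval (fun _ : Fin n => ξ) j).map_eq] at h1
  rw [Measure.map_prod_map _ _ measurable_fst measurable_snd, ← h1,
    Measure.map_map (by fun_prop) (by fun_prop),
    integral_map (by fun_prop) hmeas.aestronglyMeasurable] at hcentered
  exact hcentered

theorem ust_term {X Y : Type*} [MeasurableSpace X] [MeasurableSpace Y]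
    (ξ : Measure (X × Y)) [IsProbabilityMeasure ξ]
    (h : X × Y → ℝ) (hmeas : Measurable h)
    (B : ℝ) (hBpos : 0 < B) (hB : ∀ p, |h p| ≤ B)
    (hcentered : ∫ p, h p ∂((ξ.map Prod.fst).prod (ξ.map Prod.snd)) = 0)
    (n : ℕ) (i j k l : Fin n) :
    ∫ ω, h ((ω i).1, (ω j).2) * h ((ω k).1, (ω l).2) ∂(Measure.pi fun _ : Fin n => ξ) ≤
      B ^ 2 * ((if i = j then 1 else 0) + (if i = k then 1 else 0) + (if i = l then 1 else 0) +
        (if j = k then 1 else 0) + (if j = l then 1 else 0) + (if k = l then 1 else 0)) := by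
  by_cases hd : i ≠ j ∧ i ≠ k ∧ i ≠ l ∧ j ≠ k ∧ j ≠ l ∧ k ≠ l
  · obtain ⟨h1, h2, h3, h4, h5, h6⟩ := hd
    have hind : ProbabilityTheory.iIndepFun (fun (i : Fin n) (ω : Fin n → X × Y) => ω i)
        (Measure.pi fun _ : Fin n => ξ) :=
      ProbabilityTheory.iIndepFun_pi (X := fun _ => id) (fun _ => aemeasurable_id)
    have h7 := hind.indepFun_prodMk_prodMk (by fun_prop) i j k l h2 h3 h4 h5
    have hφ : Measurable (fun q : (X × Y) × (X × Y) => h (q.1.1, q.2.2)) := by fun_prop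
    have h8 := h7.comp hφ hφ
    have h9 := h8.integral_fun_mul_eq_mul_integral
      (Measurable.aestronglyMeasurable (by fun_prop)) (Measurable.aestronglyMeasurable (by fun_prop))
    simp only [Function.comp_def] at h9
    rw [h9, ust_mean ξ h hmeas hcentered n i j h1]
    simp [h1, h2, h3, h4, h5, h6]
  · have h1 : ∫ ω, h ((ω i).1, (ω j).2) * h ((ω k).1, (ω l).2)
        ∂(Measure.pi fun _ : Fin n => ξ) ≤ B ^ 2 := by
      have := norm_integral_le_of_norm_le_const (μ := Measure.pi fun _ : Fin n => ξ)
        (f := fun ω => h ((ω i).1, (ω j).2) * h ((ω k).1, (ω l).2)) (C := B ^ 2)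
        (Filter.Eventually.of_forall fun ω => by
          rw [norm_mul, sq]
          exact mul_le_mul (hB _) (hB _) (norm_nonneg _) hBpos.le)
      refine (le_abs_self _).trans ?_
      simpa using this
    refine h1.trans (le_mul_of_one_le_right (by positivity) ?_)
    split_ifs <;> first | (exact absurd ⟨‹_›, ‹_›, ‹_›, ‹_›, ‹_›, ‹_›⟩ hd) | norm_num

theorem ust_second {X Y : Type*} [MeasurableSpace X] [MeasurableSpace Y]
    (ξ : Measure (X × Y)) [IsProbabilityMeasure ξ]
    (h : X × Y → ℝ) (hmeas : Measurable h)
    (B : ℝ) (hBpos : 0 < B) (hB : ∀ p, |h p| ≤ B)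
    (hcentered : ∫ p, h p ∂((ξ.map Prod.fst).prod (ξ.map Prod.snd)) = 0)
    (n : ℕ) :
    ∫ ω, (∑ i : Fin n, ∑ j : Fin n, h ((ω i).1, (ω j).2)) ^ 2 ∂(Measure.pi fun _ : Fin n => ξ) ≤
      6 * B ^ 2 * n ^ 3 := by
  have hint : ∀ i j k l : Fin n, Integrable (fun ω : Fin n → X × Y =>
      h ((ω i).1, (ω j).2) * h ((ω k).1, (ω l).2)) (Measure.pi fun _ : Fin n => ξ) := by
    intro i j k l
    refine ust_int_bdd _ _ (by fun_prop) (B * B) fun ω => ?_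
    rw [abs_mul]
    exact mul_le_mul (hB _) (hB _) (abs_nonneg _) hBpos.le
  have e : ∀ ω : Fin n → X × Y, (∑ i : Fin n, ∑ j : Fin n, h ((ω i).1, (ω j).2)) ^ 2 =
      ∑ i, ∑ j, ∑ k, ∑ l, h ((ω i).1, (ω j).2) * h ((ω k).1, (ω l).2) := by
    intro ω
    rw [sq, Finset.sum_mul]
    refine Finset.sum_congr rfl fun i _ => ?_
    rw [Finset.sum_mul]
    simp only [Finset.mul_sum]
  simp_rw [e]
  have e2 : ∫ ω : Fin n → X × Y, ∑ i, ∑ j, ∑ k, ∑ l, h ((ω i).1, (ω j).2) * h ((ω k).1, (ω l).2)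
      ∂(Measure.pi fun _ : Fin n => ξ) = ∑ i, ∑ j, ∑ k, ∑ l,
      ∫ ω : Fin n → X × Y, h ((ω i).1, (ω j).2) * h ((ω k).1, (ω l).2)
      ∂(Measure.pi fun _ : Fin n => ξ) := by
    rw [integral_finsetSum _ fun i _ => integrable_finsetSum _ fun j _ => integrable_finsetSum _
      fun k _ => integrable_finsetSum _ fun l _ => hint i j k l]
    refine Finset.sum_congr rfl fun i _ => ?_
    rw [integral_finsetSum _ fun j _ => integrable_finsetSum _
      fun k _ => integrable_finsetSum _ fun l _ => hint i j k l]
    refine Finset.sum_congr rfl fun j _ => ?_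
    rw [integral_finsetSum _ fun k _ => integrable_finsetSum _ fun l _ => hint i j k l]
    refine Finset.sum_congr rfl fun k _ => ?_
    rw [integral_finsetSum _ fun l _ => hint i j k l]
  rw [e2]
  calc _ ≤ ∑ i : Fin n, ∑ j : Fin n, ∑ k : Fin n, ∑ l : Fin n,
      B ^ 2 * ((if i = j then 1 else 0) + (if i = k then 1 else 0) + (if i = l then 1 else 0) +
        (if j = k then 1 else 0) + (if j = l then 1 else 0) + (if k = l then 1 else 0)) := by
        gcongr with i _ j _ k _ l _
        exact ust_term ξ h hmeas B hBpos hB hcentered n i j k l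
    _ = 6 * B ^ 2 * n ^ 3 := by
        simp only [← Finset.mul_sum, Finset.sum_add_distrib, Finset.sum_ite_eq, Finset.mem_univ,
          if_true, Finset.sum_const, Finset.card_univ, Fintype.card_fin, nsmul_eq_mul, mul_ite,
          mul_one, mul_zero]
        ring

theorem ust_bdiff {X Y : Type*} (h : X × Y → ℝ) (B : ℝ) (hB : ∀ p, |h p| ≤ B)
    (n : ℕ) (hn : 1 ≤ n) (k : Fin n) (ω ω' : Fin n → X × Y) (hk : ∀ i, i ≠ k → ω i = ω' i) :
    |(|(1 / (n : ℝ) ^ 2) * ∑ i : Fin n, ∑ j : Fin n, h ((ω i).1, (ω j).2)| -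
      |(1 / (n : ℝ) ^ 2) * ∑ i : Fin n, ∑ j : Fin n, h ((ω' i).1, (ω' j).2)|)| ≤ 4 * B / n := by
  have hn0 : (0 : ℝ) < n := by exact_mod_cast hn
  refine (abs_abs_sub_abs_le_abs_sub _ _).trans ?_
  rw [← mul_sub, ← Finset.sum_sub_distrib, abs_mul, abs_of_pos (by positivity)]
  simp_rw [← Finset.sum_sub_distrib]
  have key : |∑ i : Fin n, ∑ j : Fin n, (h ((ω i).1, (ω j).2) - h ((ω' i).1, (ω' j).2))| ≤
      ∑ i : Fin n, ∑ j : Fin n,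
        2 * B * ((if i = k then 1 else 0) + (if j = k then 1 else 0)) := by
    refine (Finset.abs_sum_le_sum_abs _ _).trans (Finset.sum_le_sum fun i _ => ?_)
    refine (Finset.abs_sum_le_sum_abs _ _).trans (Finset.sum_le_sum fun j _ => ?_)
    have hb := (abs_sub (h ((ω i).1, (ω j).2)) (h ((ω' i).1, (ω' j).2))).trans
      (add_le_add (hB _) (hB _))
    have hB0 : 0 ≤ B := (abs_nonneg _).trans (hB ((ω i).1, (ω j).2))
    by_cases hi : i = k <;> by_cases hj : j = k
    · simp only [hi, hj, if_true] at hb ⊢; linarith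
    · simp only [hi, hj, if_true, if_false] at hb ⊢; linarith
    · simp only [hi, hj, if_true, if_false] at hb ⊢; linarith
    · simp [hi, hj, hk i hi, hk j hj]
  have ev : ∑ i : Fin n, ∑ j : Fin n,
        2 * B * ((if i = k then 1 else 0) + (if j = k then (1:ℝ) else 0)) = 4 * B * n := by
    simp only [← Finset.mul_sum, Finset.sum_add_distrib, Finset.sum_ite_eq', Finset.mem_univ,
          if_true, Finset.sum_const, Finset.card_univ, Fintype.card_fin, nsmul_eq_mul, mul_ite,
          mul_one, mul_zero]
    ring
  rw [ev] at key
  calc _ ≤ 1 / (n : ℝ) ^ 2 * (4 * B * n) := by gcongr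
    _ = _ := by field_simp

/-- Probabilistic form of the U-statistics lemma (Lemma D.1) with explicit
constants: for the centered U-statistic Uₙ = (1/n²)·Σᵢⱼ h(zᵢ, wⱼ) built from n
i.i.d. samples of ξ, and every s > 0, P(|Uₙ| ≥ √6·B/√n + s) ≤ 2·exp(-n s²/(8B²)). -/
theorem ustatistic_concentration
    {X Y : Type*} [MeasurableSpace X] [MeasurableSpace Y]
    (ξ : Measure (X × Y)) [IsProbabilityMeasure ξ]
    (h : X × Y → ℝ) (hmeas : Measurable h)
    (B : ℝ) (hBpos : 0 < B) (hB : ∀ p, |h p| ≤ B)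
    (hcentered : ∫ p, h p ∂((ξ.map Prod.fst).prod (ξ.map Prod.snd)) = 0)
    (n : ℕ) (hn : 1 ≤ n) :
    ∀ s : ℝ, 0 < s →
      (Measure.pi fun _ : Fin n => ξ)
        {ω : Fin n → X × Y |
          Real.sqrt 6 * B / Real.sqrt n + s ≤
            |(1 / (n : ℝ) ^ 2) *
              ∑ i : Fin n, ∑ j : Fin n, h ((ω i).1, (ω j).2)|} ≤
      ENNReal.ofReal (2 * Real.exp (-(n * s ^ 2) / (8 * B ^ 2))) := by
  intro s hs
  have hn0 : (0 : ℝ) < n := by exact_mod_cast hn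
  set F : (Fin n → X × Y) → ℝ := fun ω => |(1 / (n : ℝ) ^ 2) *
              ∑ i : Fin n, ∑ j : Fin n, h ((ω i).1, (ω j).2)| with hFdef
  have hF : Measurable F := by
    have : Measurable fun ω : Fin n → X × Y => (1 / (n : ℝ) ^ 2) *
        ∑ i : Fin n, ∑ j : Fin n, h ((ω i).1, (ω j).2) := by fun_prop
    exact this.abs
  have hM : ∀ ω, |F ω| ≤ B := fun ω => by
    rw [hFdef]
    simp only
    rw [abs_abs, abs_mul, abs_of_pos (by positivity)]
    have : |∑ i : Fin n, ∑ j : Fin n, h ((ω i).1, (ω j).2)| ≤ ∑ i : Fin n, ∑ j : Fin n, B :=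
      (Finset.abs_sum_le_sum_abs _ _).trans (Finset.sum_le_sum fun i _ =>
        (Finset.abs_sum_le_sum_abs _ _).trans (Finset.sum_le_sum fun j _ => hB _))
    simp only [Finset.sum_const, Finset.card_univ, Fintype.card_fin, nsmul_eq_mul] at this
    calc _ ≤ 1 / (n : ℝ) ^ 2 * (n * (n * B)) := by gcongr
      _ = B := by field_simp
  have hmc := ust_mcdiarmid ξ B (4 * B / n) n F hF hM
    (fun k ω ω' hk => ust_bdiff h B hB n hn k ω ω' hk) s hs.le
  set P := Measure.pi fun _ : Fin n => ξ with hP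
  set m := ∫ ω, F ω ∂P with hm
  have hFi : Integrable F P := ust_int_bdd _ _ hF B hM
  have hF2i : Integrable (fun ω => F ω ^ 2) P := ust_int_bdd _ _ (hF.pow_const 2) (B ^ 2)
    fun ω => by rw [abs_pow]; gcongr; exact hM ω
  have hsq : ∫ ω, F ω ^ 2 ∂P ≤ 6 * B ^ 2 / n := by
    have e : ∀ ω, F ω ^ 2 = (1 / (n : ℝ) ^ 4) *
        (∑ i : Fin n, ∑ j : Fin n, h ((ω i).1, (ω j).2)) ^ 2 := fun ω => by
      rw [hFdef]; simp only; rw [sq_abs]; ring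
    simp_rw [e]
    rw [integral_const_mul]
    calc _ ≤ 1 / (n : ℝ) ^ 4 * (6 * B ^ 2 * n ^ 3) := by
          gcongr
          exact ust_second ξ h hmeas B hBpos hB hcentered n
      _ = _ := by field_simp
  have hm2 : m ^ 2 ≤ ∫ ω, F ω ^ 2 ∂P := by
    have h0 : 0 ≤ ∫ ω, (F ω - m) ^ 2 ∂P := integral_nonneg fun ω => sq_nonneg _
    have h1 : ∫ ω, (F ω - m) ^ 2 ∂P = ∫ ω, F ω ^ 2 ∂P - m ^ 2 := by
      have : ∀ ω, (F ω - m) ^ 2 = F ω ^ 2 - ((2 * m) * F ω - m ^ 2) := fun ω => by ring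
      simp_rw [this]
      have hi : Integrable (fun ω => (2 * m) * F ω - m ^ 2) P :=
        (hFi.const_mul _).sub (integrable_const _)
      rw [integral_sub hF2i hi,
        integral_sub (hFi.const_mul _) (integrable_const _), integral_const_mul, ← hm]
      simp
      ring
    linarith
  have hmle : m ≤ Real.sqrt 6 * B / Real.sqrt n := by
    refine le_of_sq_le_sq ?_ (by positivity)
    rw [div_pow, mul_pow, Real.sq_sqrt (by norm_num), Real.sq_sqrt hn0.le]
    exact hm2.trans hsq
  have hsub : {ω : Fin n → X × Y | Real.sqrt 6 * B / Real.sqrt n + s ≤ F ω} ⊆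
      {ω | s ≤ F ω - m} := fun ω hω => by
    change _ ≤ F ω at hω
    change s ≤ F ω - m
    linarith
  refine (measure_mono hsub).trans ?_
  rw [← ofReal_measureReal]
  refine ENNReal.ofReal_le_ofReal (hmc.trans ?_)
  have : - s ^ 2 / (2 * (n * (4 * B / n) ^ 2 / 4)) = -(n * s ^ 2) / (8 * B ^ 2) := by
    field_simp
    norm_num
  rw [this]
  linarith [Real.exp_pos (-(n * s ^ 2) / (8 * B ^ 2))]
end
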